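/- Let 𝒜 be a set of ordered graphs that does not have the sparse rainbow strong EH-property. Then for every tree T there is a numbering of T such that the ordered graph formed by T with this numbering contains no member of 𝒜. -/

import Mathlib

/-- A blockade: a family of pairwise disjoint nonempty blocks. -/
def IsBlockade {n k : ℕ} (B : Fin k → Finset (Fin n)) : Prop :=
  (∀ i, (B i).Nonempty) ∧ ∀ i j : Fin k, i ≠ j → Disjoint (B i) (B j)

/-- The width of a blockade: the minimum cardinality of a block. -/
noncomputable def blockadeWidth {n k : ℕ} (B : Fin k → Finset (Fin n)) : ℕ :=
  ⨅ i, (B i).card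
/-- Containment of ordered graphs (graphs on `Fin m` with the natural numbering):
an induced subgraph with the induced numbering is isomorphic to `H` as an ordered graph. -/
def OContains {n m : ℕ} (G : SimpleGraph (Fin n)) (H : SimpleGraph (Fin m)) : Prop :=
  ∃ f : Fin m → Fin n, StrictMono f ∧ ∀ u v, H.Adj u v ↔ G.Adj (f u) (f v)
/-- A blockade respects the numbering: blocks occur consecutively in order. -/
def Respectful {n k : ℕ} (B : Fin k → Finset (Fin n)) : Prop :=
  ∀ i j : Fin k, i < j → ∀ u ∈ B i, ∀ v ∈ B j, u < v

/-- A rainbow copy of the ordered graph `H` in the ordered graph `G`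
with respect to the blockade `B`. -/
def ORainbow {n m k : ℕ} (G : SimpleGraph (Fin n)) (H : SimpleGraph (Fin m))
    (B : Fin k → Finset (Fin n)) : Prop :=
  ∃ f : Fin m → Fin n, StrictMono f ∧ (∀ u v, H.Adj u v ↔ G.Adj (f u) (f v)) ∧
    ∃ β : Fin m → Fin k, Function.Injective β ∧ ∀ u, f u ∈ B (β u)

/-- The degree of a vertex in a graph. -/
noncomputable def gdeg {n : ℕ} (G : SimpleGraph (Fin n)) (v : Fin n) : ℕ :=
  Nat.card {u : Fin n | G.Adj v u}

/-- An anticomplete pair of order at least `t` in a graph. -/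
def HasAnticompletePair {n : ℕ} (G : SimpleGraph (Fin n)) (t : ℝ) : Prop :=
  ∃ A B : Finset (Fin n), Disjoint A B ∧ (∀ a ∈ A, ∀ b ∈ B, ¬ G.Adj a b) ∧
    t ≤ A.card ∧ t ≤ B.card

/-- An ordered graph: a graph on `Fin m`, carrying the natural numbering. -/
abbrev OGraph := Σ m : ℕ, SimpleGraph (Fin m)

/-- The sparse rainbow strong EH-property for a set of ordered graphs. -/
def SRSEH (𝒜 : Set OGraph) : Prop :=
  ∃ c : ℝ, 0 < c ∧ c < 1 ∧
    ∀ (n k : ℕ) (G : SimpleGraph (Fin n)) (B : Fin k → Finset (Fin n)),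
      IsBlockade B → Respectful B → 1 / c ≤ (k : ℝ) →
      (∀ H ∈ 𝒜, ¬ ORainbow G H.2 B) →
      (∀ v, (gdeg G v : ℝ) < c * blockadeWidth B) →
      HasAnticompletePair G (c * blockadeWidth B)

namespace TN
open Filter Classical

section Fin
variable {V : Type*} (G : SimpleGraph V)

/-- vertices of `D` with a neighbour in `X`. -/
noncomputable def nb (X D : Finset V) : Finset V := D.filter (fun v => ∃ x ∈ X, G.Adj x v)
/-- vertices of `D` with no neighbour in `X`. -/
noncomputable def nn (X D : Finset V) : Finset V := D.filter (fun v => ¬ ∃ x ∈ X, G.Adj x v)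
/-- number of neighbours of `v` in `A`. -/
noncomputable def dg (A : Finset V) (v : V) : ℕ := (A.filter (fun u => G.Adj v u)).card

variable {G}
lemma mem_nb {X D : Finset V} {v : V} : v ∈ nb G X D ↔ v ∈ D ∧ ∃ x ∈ X, G.Adj x v := by
  simp [nb]
lemma mem_nn {X D : Finset V} {v : V} : v ∈ nn G X D ↔ v ∈ D ∧ ∀ x ∈ X, ¬ G.Adj x v := by
  simp [nn]
lemma nb_sub (X D : Finset V) : nb G X D ⊆ D := Finset.filter_subset _ _
lemma nn_sub (X D : Finset V) : nn G X D ⊆ D := Finset.filter_subset _ _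
lemma nb_add_nn (X D : Finset V) : (nb G X D).card + (nn G X D).card = D.card :=
  Finset.card_filter_add_card_filter_not _

lemma nb_mono {X X' D D' : Finset V} (h : X ⊆ X') (h' : D ⊆ D') : nb G X D ⊆ nb G X' D' := by
  intro v; simp only [mem_nb]; rintro ⟨a, x, hx, hv⟩; exact ⟨h' a, x, h hx, hv⟩

lemma nb_singleton (v : V) (D : Finset V) : (nb G {v} D).card = dg G D v := by
  simp [nb, dg]

lemma nb_union_card (X Y D : Finset V) :
    (nb G (X ∪ Y) D).card ≤ (nb G X D).card + (nb G Y D).card := by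
  refine le_trans (Finset.card_le_card ?_) (Finset.card_union_le _ _)
  intro v; simp only [mem_nb, Finset.mem_union]; rintro ⟨a, x, hx | hx, hv⟩
  · exact Or.inl ⟨a, x, hx, hv⟩
  · exact Or.inr ⟨a, x, hx, hv⟩

lemma dg_double (A B : Finset V) : ∑ v ∈ A, dg G B v = ∑ x ∈ B, dg G A x := by
  simp only [dg, Finset.card_filter]
  rw [Finset.sum_comm]
  simp only [G.adj_comm]

lemma greedy {ι : Type*} (A X : Finset V) (J : Finset ι) (Y : ι → Finset V)
    (s θ C w m M : ℕ) (hθ : 1 ≤ θ) (hX : ∀ x ∈ X, θ ≤ s * dg G A x)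
    (hY : ∀ j ∈ J, ∀ y ∈ Y j, dg G A y ≤ C * θ) (hw : w ≤ m * X.card)
    (hYw : ∀ j ∈ J, (Y j).card ≤ w) (hdeg : ∀ v, 2 * M * dg G X v ≤ w) (hM : 2 * m ≤ M) :
    ∃ Z ⊆ A, ∑ j ∈ J, (nb G Z (Y j)).card ≤ (2 * m * s * J.card * C + 1) * (nb G Z X).card ∧
      M * (nb G Z X).card ≤ w ∧ w ≤ 2 * M * (nb G Z X).card := by
  set R := 2 * m * s * J.card * C + 1 with hR
  set F := A.powerset.filter (fun Z => ∑ j ∈ J, (nb G Z (Y j)).card ≤ R * (nb G Z X).card ∧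
      M * (nb G Z X).card ≤ w) with hF
  have hne : F.Nonempty := ⟨∅, by
    rw [hF, Finset.mem_filter]; simp [nb]⟩
  obtain ⟨Z, hZF, hZmax⟩ := Finset.exists_max_image F (fun Z => (nb G Z X).card) hne
  simp only [hF, Finset.mem_filter, Finset.mem_powerset] at hZF
  obtain ⟨hZA, hZ1, hZ2⟩ := hZF
  refine ⟨Z, hZA, hZ1, hZ2, ?_⟩
  by_contra hlt
  push Not at hlt
  have hcard := nb_add_nn (G := G) Z X
  set X' := nn G Z X with hX'
  have hbig : X.card ≤ 2 * X'.card := by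
    by_contra h
    have h1 : X.card < 2 * (nb G Z X).card := by omega
    have : m * X.card ≤ m * (2 * (nb G Z X).card) := Nat.mul_le_mul_left _ h1.le
    nlinarith [Nat.zero_le (nb G Z X).card]
  have hX0 : 0 < X.card := by
    rcases Nat.eq_zero_or_pos X.card with h | h
    · rw [h] at hw; omega
    · exact h
  have key : ∃ v ∈ A, ∑ j ∈ J, dg G (Y j) v < R * dg G X' v := by
    by_contra hcon
    push Not at hcon
    have h1 : R * ∑ v ∈ A, dg G X' v ≤ ∑ v ∈ A, ∑ j ∈ J, dg G (Y j) v := by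
      rw [Finset.mul_sum]; exact Finset.sum_le_sum hcon
    rw [Finset.sum_comm] at h1
    have h2 : ∑ j ∈ J, ∑ v ∈ A, dg G (Y j) v ≤ J.card * (w * (C * θ)) := by
      rw [← smul_eq_mul, ← Finset.sum_const]
      refine Finset.sum_le_sum fun j hj => ?_
      rw [dg_double]
      refine le_trans (Finset.sum_le_card_nsmul _ _ (C * θ) (hY j hj)) ?_
      rw [smul_eq_mul]; exact Nat.mul_le_mul_right _ (hYw j hj)
    have h3 : X'.card * θ ≤ s * ∑ v ∈ A, dg G X' v := by
      rw [dg_double, Finset.mul_sum, ← smul_eq_mul]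
      refine Finset.card_nsmul_le_sum _ _ _ fun x hx => hX x (nn_sub _ _ hx)
    set S := ∑ v ∈ A, dg G X' v
    have hS : 0 < S := by
      rcases Nat.eq_zero_or_pos S with h | h
      · rw [h] at h3
        have : 0 < X'.card * θ := Nat.mul_pos (by omega) hθ
        omega
      · exact h
    have h4 : J.card * (w * (C * θ)) ≤ (2 * m * s * J.card * C) * S := by
      calc J.card * (w * (C * θ)) ≤ J.card * ((m * (2 * X'.card)) * (C * θ)) := by
            gcongr; exact hw.trans (Nat.mul_le_mul_left _ hbig)
        _ = (2 * m * J.card * C) * (X'.card * θ) := by ring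
        _ ≤ (2 * m * J.card * C) * (s * S) := by gcongr
        _ = _ := by ring
    have : R * S ≤ (2 * m * s * J.card * C) * S := h1.trans (h2.trans h4)
    rw [hR] at this
    nlinarith
  obtain ⟨v, hvA, hv⟩ := key
  have hXeq : (nb G (Z ∪ {v}) X).card = (nb G Z X).card + dg G X' v := by
    rw [← nb_singleton, ← Finset.card_union_of_disjoint]
    · congr 1; ext u
      simp only [mem_nb, mem_nn, hX', Finset.mem_union, Finset.mem_singleton]
      grind
    · rw [Finset.disjoint_left]; intro u
      simp only [mem_nb, mem_nn, hX']; grind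
  have hle : dg G X' v ≤ dg G X v := by
    unfold dg; exact Finset.card_le_card (Finset.filter_subset_filter _ (nn_sub _ _))
  have hmem : Z ∪ {v} ∈ F := by
    simp only [hF, Finset.mem_filter, Finset.mem_powerset]
    refine ⟨Finset.union_subset hZA (by simpa using hvA), ?_, ?_⟩
    · calc _ ≤ ∑ j ∈ J, ((nb G Z (Y j)).card + dg G (Y j) v) :=
            Finset.sum_le_sum fun j _ => by rw [← nb_singleton]; exact nb_union_card _ _ _
        _ = _ := Finset.sum_add_distrib
        _ ≤ R * (nb G Z X).card + R * dg G X' v := add_le_add hZ1 hv.le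
        _ = _ := by rw [hXeq]; ring
    · rw [hXeq]; have := hdeg v
      have : 2 * M * dg G X' v ≤ w := le_trans (Nat.mul_le_mul_left _ hle) (hdeg v)
      nlinarith
  have := hZmax _ hmem
  have hpos : 0 < dg G X' v := by
    rcases Nat.eq_zero_or_pos (dg G X' v) with h | h
    · rw [h] at hv; omega
    · exact h
  simp only [hXeq] at this; omega
end Fin

/-- An asymptotic sparse coherent sequence of coloured graphs. -/
structure Ctx where
  V : ℕ → Type
  G : ∀ n, SimpleGraph (V n)
  col : ∀ n, V n → ℕ
  W : ℕ → ℕ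
  U : Ultrafilter ℕ
  hW : ∀ᶠ n in U, 0 < W n
  hdeg : ∀ m : ℕ, ∀ᶠ n in U, ∀ v (S : Finset (V n)), m * dg (G n) S v < W n
  hcoh : ∀ m : ℕ, ∀ᶠ n in U, ∀ X Y : Finset (V n), Disjoint X Y → W n ≤ m * X.card →
    W n ≤ m * Y.card → ∃ x ∈ X, ∃ y ∈ Y, (G n).Adj x y

namespace Ctx
variable (c : Ctx)

abbrev ISet := ∀ n, Finset (c.V n)
variable {c}
def Big (X : c.ISet) : Prop := ∃ m : ℕ, ∀ᶠ n in c.U, c.W n ≤ m * (X n).card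

lemma not_big {X : c.ISet} : ¬ Big X ↔ ∀ m : ℕ, ∀ᶠ n in c.U, m * (X n).card < c.W n := by
  simp only [Big, not_exists, ← Ultrafilter.eventually_not, not_le]

lemma Big.mono {X Y : c.ISet} (h : Big X) (hs : ∀ᶠ n in c.U, X n ⊆ Y n) : Big Y := by
  obtain ⟨m, hm⟩ := h
  exact ⟨m, by filter_upwards [hm, hs] with n h1 h2; exact (h1.trans
    (Nat.mul_le_mul_left _ (Finset.card_le_card h2)))⟩

lemma Big.mono' {X Y : c.ISet} (h : Big X) (hs : ∀ n, X n ⊆ Y n) : Big Y :=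
  h.mono (Eventually.of_forall hs)

lemma Big.union {X Y Z : c.ISet} (h : Big X) (hs : ∀ᶠ n in c.U, X n ⊆ Y n ∪ Z n) :
    Big Y ∨ Big Z := by
  by_contra hcon
  push Not at hcon
  rw [not_big, not_big] at hcon
  obtain ⟨m, hm⟩ := h
  obtain ⟨n, h1, h2, h3, h4⟩ :=
    (hm.and (hs.and ((hcon.1 (2 * m)).and (hcon.2 (2 * m))))).exists
  have := (Finset.card_le_card h2).trans (Finset.card_union_le _ _)
  nlinarith [Nat.mul_le_mul_left m this]

lemma not_big_empty : ¬ Big (c := c) (fun _ => ∅) := by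
  rw [not_big]; intro m; simpa using c.hW

lemma Big.nonempty {X : c.ISet} (h : Big X) : ∀ᶠ n in c.U, (X n).Nonempty := by
  obtain ⟨m, hm⟩ := h
  filter_upwards [hm, c.hW] with n h1 h2
  rw [← Finset.card_pos]
  by_contra h
  simp at h; simp [h] at h1; omega

lemma Big.biUnion {ι : Type*} {s : Finset ι} {F : ι → c.ISet} {X : c.ISet} (h : Big X)
    (hs : ∀ᶠ n in c.U, X n ⊆ s.biUnion (fun i => F i n)) : ∃ i ∈ s, Big (F i) := by
  induction s using Finset.induction_on generalizing X with
  | empty => exact absurd (h.mono (Y := fun _ => ∅) (by simpa using hs)) not_big_empty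
  | insert a s ha ih =>
    rcases h.union (Y := F a) (Z := fun n => s.biUnion (fun i => F i n))
      (by simpa [Finset.biUnion_insert] using hs) with h | h
    · exact ⟨a, by simp, h⟩
    · obtain ⟨i, hi, hb⟩ := ih h (Eventually.of_forall fun _ => subset_rfl)
      exact ⟨i, by simp [hi], hb⟩

lemma Big.pigeon {ι : Type*} {s : Finset ι} {P : ι → ∀ n, c.V n → Prop} [∀ i n, DecidablePred (P i n)] {X : c.ISet} (h : Big X)
    (hs : ∀ᶠ n in c.U, ∀ x ∈ X n, ∃ i ∈ s, P i n x) :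
    ∃ i ∈ s, Big (fun n => (X n).filter (P i n)) := by
  refine h.biUnion ?_
  filter_upwards [hs] with n hn x hx
  obtain ⟨i, hi, hp⟩ := hn x hx
  simp only [Finset.mem_biUnion, Finset.mem_filter]; exact ⟨i, hi, hx, hp⟩

lemma Big.split {X : c.ISet} (h : Big X) (P : ∀ n, c.V n → Prop)
    [∀ n, DecidablePred (P n)] :
    Big (fun n => (X n).filter (P n)) ∨ Big (fun n => (X n).filter (fun x => ¬ P n x)) := by
  refine h.union (Eventually.of_forall fun n x hx => ?_)
  simp only [Finset.mem_union, Finset.mem_filter]; tauto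

/-- If `X` is big then removing a small part keeps it big. -/
lemma Big.nn_of_not {X Z : c.ISet} (h : Big X) (hn : ¬ Big (fun n => nb (c.G n) (Z n) (X n))) :
    Big (fun n => nn (c.G n) (Z n) (X n)) := by
  refine (h.union (Eventually.of_forall fun n x hx => ?_)).resolve_left hn
  simp only [Finset.mem_union, mem_nb, mem_nn]; grind

lemma ev_exists {ι : Type*} {s : Finset ι} {p : ι → ℕ → Prop}
    (h : ∀ᶠ n in c.U, ∃ i ∈ s, p i n) : ∃ i ∈ s, ∀ᶠ n in c.U, p i n := by
  by_contra hcon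
  push Not at hcon
  have : ∀ᶠ n in c.U, ∀ i ∈ s, ¬ p i n := by
    rw [Filter.eventually_all_finset]
    intro i hi; rw [Ultrafilter.eventually_not]; simpa using hcon i hi
  obtain ⟨n, ⟨i, hi, h1⟩, h2⟩ := (h.and this).exists
  exact h2 i hi h1

/-- a common constant for finitely many big sets -/
lemma Big.common {ι : Type*} (s : Finset ι) {F : ι → c.ISet} (h : ∀ i ∈ s, Big (F i)) :
    ∃ m : ℕ, 0 < m ∧ ∀ᶠ n in c.U, ∀ i ∈ s, c.W n ≤ m * (F i n).card := by
  choose! m hm using h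
  refine ⟨∑ i ∈ s, m i + 1, by omega, ?_⟩
  rw [Filter.eventually_all_finset]
  intro i hi
  filter_upwards [hm i hi] with n hn
  refine hn.trans (Nat.mul_le_mul_right _ ?_)
  have := Finset.single_le_sum (f := m) (fun _ _ => Nat.zero_le _) hi
  omega

/-- ultraproduct form of the greedy lemma -/
lemma greedyU {ι : Type*} (A X : c.ISet) (J : Finset ι) (Y : ι → c.ISet) (s C : ℕ) (θ : ℕ → ℕ)
    (hθ : ∀ᶠ n in c.U, 1 ≤ θ n) (hX : ∀ᶠ n in c.U, ∀ x ∈ X n, θ n ≤ s * dg (c.G n) (A n) x)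
    (hY : ∀ᶠ n in c.U, ∀ j ∈ J, ∀ y ∈ Y j n, dg (c.G n) (A n) y ≤ C * θ n)
    (hYw : ∀ᶠ n in c.U, ∀ j ∈ J, (Y j n).card ≤ c.W n) (hXb : Big X) (hYb : ∀ j ∈ J, Big (Y j)) :
    ∃ Z : c.ISet, (∀ n, Z n ⊆ A n) ∧ Big (fun n => nb (c.G n) (Z n) (X n)) ∧
      ∀ j ∈ J, Big (fun n => nn (c.G n) (Z n) (Y j n)) := by
  obtain ⟨m, hm⟩ := hXb
  obtain ⟨m', hm'0, hm'⟩ := Big.common J hYb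
  set R := 2 * m * s * J.card * C + 1
  set M := 2 * m + 2 * m' * R
  have main : ∀ᶠ n in c.U, ∃ Z ⊆ A n, ∑ j ∈ J, (nb (c.G n) Z (Y j n)).card ≤ R * (nb (c.G n) Z (X n)).card ∧
      M * (nb (c.G n) Z (X n)).card ≤ c.W n ∧ c.W n ≤ 2 * M * (nb (c.G n) Z (X n)).card := by
    filter_upwards [hθ, hX, hY, hYw, hm, c.hdeg (2 * M)] with n h1 h2 h3 h4 h5 h6
    exact greedy (A n) (X n) J (fun j => Y j n) s (θ n) C (c.W n) m M h1 h2 h3 h5 h4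
      (fun v => (h6 v _).le) (by omega)
  have : ∀ n, ∃ Z ⊆ A n, (∃ Z ⊆ A n, ∑ j ∈ J, (nb (c.G n) Z (Y j n)).card ≤ R * (nb (c.G n) Z (X n)).card ∧
      M * (nb (c.G n) Z (X n)).card ≤ c.W n ∧ c.W n ≤ 2 * M * (nb (c.G n) Z (X n)).card) →
      (∑ j ∈ J, (nb (c.G n) Z (Y j n)).card ≤ R * (nb (c.G n) Z (X n)).card ∧
      M * (nb (c.G n) Z (X n)).card ≤ c.W n ∧ c.W n ≤ 2 * M * (nb (c.G n) Z (X n)).card) := by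
    intro n
    by_cases h : (∃ Z ⊆ A n, ∑ j ∈ J, (nb (c.G n) Z (Y j n)).card ≤ R * (nb (c.G n) Z (X n)).card ∧
      M * (nb (c.G n) Z (X n)).card ≤ c.W n ∧ c.W n ≤ 2 * M * (nb (c.G n) Z (X n)).card)
    · obtain ⟨Z, hZ, h'⟩ := h; exact ⟨Z, hZ, fun _ => h'⟩
    · exact ⟨∅, by simp, fun h' => absurd h' h⟩
  choose Z hZA hZ using this
  refine ⟨Z, hZA, ⟨2 * M, ?_⟩, fun j hj => ⟨2 * m', ?_⟩⟩
  · filter_upwards [main] with n hn; exact (hZ n hn).2.2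
  · filter_upwards [main, hm'] with n hn h'
    obtain ⟨h1, h2, h3⟩ := hZ n hn
    have e := nb_add_nn (G := c.G n) (Z n) (Y j n)
    have h4 := h' j hj
    have h5 : (nb (c.G n) (Z n) (Y j n)).card ≤ R * (nb (c.G n) (Z n) (X n)).card :=
      le_trans (Finset.single_le_sum (f := fun j => (nb (c.G n) (Z n) (Y j n)).card)
        (fun _ _ => Nat.zero_le _) hj) h1
    have h6 : 2 * m' * (nb (c.G n) (Z n) (Y j n)).card ≤ c.W n := by
      calc _ ≤ 2 * m' * (R * (nb (c.G n) (Z n) (X n)).card) := Nat.mul_le_mul_left _ h5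
        _ = 2 * m' * R * (nb (c.G n) (Z n) (X n)).card := by ring
        _ ≤ M * (nb (c.G n) (Z n) (X n)).card := Nat.mul_le_mul_right _ (by omega)
        _ ≤ _ := h2
    rw [← e] at h4
    nlinarith
end Ctx
end TN

namespace TN
open Filter Classical
namespace Ctx
variable {c : Ctx} {ι : Type*}

structure Tok (D : ι → c.ISet) : Prop where
  sep : ∀ i j, i ≠ j → ∀ n, ∀ x ∈ D i n, ∀ y ∈ D j n, c.col n x ≠ c.col n y
  card : ∀ i n, (D i n).card ≤ c.W n

structure Con (D0 D : ι → c.ISet) : Prop where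
  le : ∀ i n, D i n ⊆ D0 i n
  big : ∀ i, Big (D i)

lemma Con.trans {D0 D D' : ι → c.ISet} (h : Con D0 D) (h' : Con D D') : Con D0 D' :=
  ⟨fun i n => (h'.le i n).trans (h.le i n), h'.big⟩

lemma Tok.con {D0 D : ι → c.ISet} (h : Tok D0) (h' : Con D0 D) : Tok D :=
  ⟨fun i j hij n x hx y hy => h.sep i j hij n x (h'.le _ _ hx) y (h'.le _ _ hy),
    fun i n => (Finset.card_le_card (h'.le i n)).trans (h.card i n)⟩

lemma Tok.disj {D : ι → c.ISet} (h : Tok D) {i j : ι} (hij : i ≠ j) (n : ℕ) :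
    Disjoint (D i n) (D j n) := by
  rw [Finset.disjoint_left]; intro x hx hy; exact h.sep i j hij n x hx x hy rfl

def Abil (D : ι → c.ISet) (i k : ι) (J : Set ι) : Prop :=
  ∃ X : c.ISet, (∀ n, X n ⊆ D i n) ∧ Big (fun n => nb (c.G n) (X n) (D k n)) ∧
    ∀ j ∈ J, Big (fun n => nn (c.G n) (X n) (D j n))

lemma nn_mono {V : Type*} {G : SimpleGraph V} {X D D' : Finset V} (h : D ⊆ D') :
    nn G X D ⊆ nn G X D' := by
  intro v; simp only [mem_nn]; rintro ⟨a, b⟩; exact ⟨h a, b⟩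

lemma Abil.anti {D : ι → c.ISet} {i k : ι} {J J' : Set ι} (h : Abil D i k J) (hJ : J' ⊆ J) :
    Abil D i k J' := by
  obtain ⟨X, h1, h2, h3⟩ := h
  exact ⟨X, h1, h2, fun j hj => h3 j (hJ hj)⟩

lemma Abil.mono {D D0 : ι → c.ISet} {i k : ι} {J : Set ι} (h : Abil D i k J)
    (hl : ∀ i n, D i n ⊆ D0 i n) : Abil D0 i k J := by
  obtain ⟨X, h1, h2, h3⟩ := h
  exact ⟨X, fun n => (h1 n).trans (hl i n), h2.mono' fun n => nb_mono subset_rfl (hl k n),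
    fun j hj => (h3 j hj).mono' fun n => nn_mono (hl j n)⟩

structure Stable (D0 : ι → c.ISet) : Prop where
  tok : Tok D0
  big : ∀ i, Big (D0 i)
  stab : ∀ D, Con D0 D → ∀ i k J, Abil D0 i k J → Abil D i k J

lemma stabilize [Finite ι] {D : ι → c.ISet} (hT : Tok D) (hB : ∀ i, Big (D i)) :
    ∃ D0, Con D D0 ∧ Stable D0 := by
  let f : {E : ι → c.ISet // Con D E} → ℕ := fun E =>
    {p : ι × ι × Set ι | Abil E.1 p.1 p.2.1 p.2.2}.ncard
  have : Nonempty {E : ι → c.ISet // Con D E} := ⟨⟨D, fun _ _ => subset_rfl, hB⟩⟩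
  let E := Function.argmin f
  refine ⟨E.1, E.2, hT.con E.2, E.2.big, fun D' h' i k J hA => ?_⟩
  have hmin := Function.argmin_le f ⟨D', E.2.trans h'⟩
  have hsub : {p : ι × ι × Set ι | Abil D' p.1 p.2.1 p.2.2} ⊆
      {p : ι × ι × Set ι | Abil E.1 p.1 p.2.1 p.2.2} := fun p hp => hp.mono h'.le
  have := Set.eq_of_subset_of_ncard_le hsub hmin (Set.toFinite _)
  have h2 : (i, k, J) ∈ {p : ι × ι × Set ι | Abil E.1 p.1 p.2.1 p.2.2} := hA
  rw [← this] at h2; exact h2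

lemma abil_comp {κ : Type*} (D : ι → c.ISet) (f : κ → ι) (i k : κ) (J : Set κ) :
    Abil (fun a => D (f a)) i k J ↔ Abil D (f i) (f k) (f '' J) := by
  simp [Abil]

lemma Stable.comp {κ : Type*} {D0 : ι → c.ISet} (h : Stable D0) (f : κ → ι)
    (hf : Function.Injective f) : Stable (fun a => D0 (f a)) := by
  refine ⟨⟨fun i j hij => h.tok.sep _ _ (hf.ne hij), fun i => h.tok.card _⟩, fun i => h.big _, ?_⟩
  intro D hD i k J hA
  rw [abil_comp] at hA
  let E : ι → c.ISet := fun x => if hx : ∃ a, f a = x then D hx.choose else D0 x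
  have hE : ∀ a, E (f a) = D a := by
    intro a
    have hx : ∃ b, f b = f a := ⟨a, rfl⟩
    simp only [E, dif_pos hx]
    rw [hf hx.choose_spec]
  have hc : Con D0 E := by
    constructor
    · intro x n
      by_cases hx : ∃ a, f a = x
      · obtain ⟨a, rfl⟩ := hx; rw [hE]; exact hD.le a n
      · simp only [E, dif_neg hx]; exact subset_rfl
    · intro x
      by_cases hx : ∃ a, f a = x
      · obtain ⟨a, rfl⟩ := hx; rw [hE]; exact hD.big a
      · simp only [E, dif_neg hx]; exact h.big x
  have h2 := h.stab E hc _ _ _ hA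
  rw [← abil_comp] at h2
  simpa only [hE] using h2

lemma dg_mono {V : Type*} {G : SimpleGraph V} {A B : Finset V} (h : A ⊆ B) (v : V) :
    dg G A v ≤ dg G B v :=
  Finset.card_le_card (Finset.filter_subset_filter _ h)

lemma dg_biUnion_le {V : Type*} {G : SimpleGraph V} (s : Finset ι) (F : ι → Finset V) (v : V) :
    dg G (s.biUnion F) v ≤ ∑ i ∈ s, dg G (F i) v := by
  unfold dg; rw [Finset.filter_biUnion]; exact Finset.card_biUnion_le

lemma median {V : Type*} (D : Finset V) (d : V → ℕ) :
    ∃ θ : ℕ, D.card ≤ 2 * (D.filter (fun x => d x ≤ θ)).card ∧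
      D.card ≤ 2 * (D.filter (fun x => θ ≤ d x)).card := by
  have hex : ∃ θ : ℕ, D.card ≤ 2 * (D.filter (fun x => d x ≤ θ)).card := by
    refine ⟨D.sup d, ?_⟩
    rw [Finset.filter_true_of_mem (fun x hx => Finset.le_sup hx)]; omega
  refine ⟨Nat.find hex, Nat.find_spec hex, ?_⟩
  have e := Finset.card_filter_add_card_filter_not (s := D) (fun x => Nat.find hex ≤ d x)
  rcases Nat.eq_zero_or_pos (Nat.find hex) with h | h
  · rw [Finset.filter_true_of_mem (fun x _ => by omega)]; omega
  · have := Nat.find_min hex (m := Nat.find hex - 1) (by omega)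
    have e2 : D.filter (fun x => d x ≤ Nat.find hex - 1) = D.filter (fun x => ¬ Nat.find hex ≤ d x) := by
      apply Finset.filter_congr; intro x _; omega
    rw [e2] at this; omega

lemma gap {D0 D : ι → c.ISet} (hT : Tok D0) (hD : Con D0 D) (Sg K : Finset ι) {h : ℕ}
    (J : Fin h → Finset ι) (hSg : Sg.Nonempty) (hJ : ∀ b, (J b).Nonempty)
    (hdj : ∀ b, Disjoint Sg (J b))
    (hg : ∀ b, ∀ l ∈ Sg, ∀ k ∈ K, ¬ Abil D0 l k (J b : Set ι)) (C : ℕ) :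
    ∃ θ : ℕ → ℕ, (∀ k ∈ K, Big (fun n => (D k n).filter
        (fun x => dg (c.G n) (Sg.biUnion (fun l => D l n)) x ≤ θ n))) ∧
      ∀ b, ∃ j ∈ J b, Big (fun n => (D j n).filter
        (fun y => C * θ n ≤ dg (c.G n) (Sg.biUnion (fun l => D l n)) y ∧
          1 ≤ dg (c.G n) (Sg.biUnion (fun l => D l n)) y)) := by
  set d : ∀ n, c.V n → ℕ := fun n x => dg (c.G n) (Sg.biUnion (fun l => D l n)) x with hd
  choose θ' hlo hhi using fun (k : ι) (n : ℕ) => median (D k n) (d n)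
  have half : ∀ (k : ι) (F : c.ISet), (∀ n, (D k n).card ≤ 2 * (F n).card) → Big F := by
    intro k F hF
    obtain ⟨m, hm⟩ := hD.big k
    refine ⟨m * 2, ?_⟩
    filter_upwards [hm] with n hn
    rw [mul_assoc]; exact hn.trans (Nat.mul_le_mul_left _ (hF n))
  set θ : ℕ → ℕ := fun n => K.sup (fun k => θ' k n) with hθ
  refine ⟨θ, fun k hk => ?_, fun b => ?_⟩
  · refine (half k _ (hlo k)).mono' fun n x => ?_
    simp only [Finset.mem_filter]
    rintro ⟨h1, h2⟩
    exact ⟨h1, h2.trans (Finset.le_sup (f := fun k => θ' k n) hk)⟩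
  · by_contra hcon
    push Not at hcon
    have hY : ∀ j ∈ J b, Big (fun n => (D j n).filter (fun y => ¬ (C * θ n ≤ d n y ∧ 1 ≤ d n y))) :=
      fun j hj => ((hD.big j).split (fun n y => C * θ n ≤ d n y ∧ 1 ≤ d n y)).resolve_left (by simpa using hcon j hj)
    by_cases h0 : ∀ᶠ n in c.U, θ n = 0
    · obtain ⟨j, hj⟩ := hJ b
      obtain ⟨l, hl⟩ := hSg
      obtain ⟨m1, hm1⟩ := hY j hj
      obtain ⟨m2, hm2⟩ := hD.big l
      have hne : l ≠ j := fun e => Finset.disjoint_left.1 (hdj b) hl (e ▸ hj)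
      obtain ⟨n, h1, h2, h3, h4⟩ := (h0.and (hm1.and (hm2.and (c.hcoh (m1 + m2))))).exists
      obtain ⟨x, hx, y, hy, hadj⟩ := h4 (D l n) ((D j n).filter
        (fun y => ¬ (C * θ n ≤ d n y ∧ 1 ≤ d n y)))
        ((hT.con hD).disj hne n |>.mono_right (Finset.filter_subset _ _))
        (h3.trans (Nat.mul_le_mul_right _ (by omega))) (h2.trans (Nat.mul_le_mul_right _ (by omega)))
      simp only [Finset.mem_filter, h1] at hy
      have : 0 < d n y := by
        simp only [hd, dg, Finset.card_pos]
        refine ⟨x, ?_⟩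
        simp only [Finset.mem_filter, Finset.mem_biUnion]
        exact ⟨⟨l, hl, hx⟩, hadj.symm⟩
      exact hy.2 ⟨by simp, this⟩
    · rw [← Ultrafilter.eventually_not] at h0
      have hK : K.Nonempty := by
        obtain ⟨n, hn⟩ := h0.exists
        rw [Finset.nonempty_iff_ne_empty]; rintro rfl; simp [hθ] at hn
      obtain ⟨k, hk, hkθ⟩ := ev_exists (c := c) (s := K) (p := fun k n => θ n = θ' k n)
        (Eventually.of_forall fun n => Finset.exists_mem_eq_sup K hK _)
      have hX := half k _ (hhi k)
      obtain ⟨l, hl, hXl⟩ := hX.pigeon (s := Sg)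
        (P := fun l n x => θ n ≤ Sg.card * dg (c.G n) (D l n) x) (by
          filter_upwards [hkθ, h0] with n hn h0 x hx
          simp only [Finset.mem_filter] at hx
          by_contra hc
          push Not at hc
          have h1 : Sg.card * d n x ≤ ∑ l ∈ Sg, Sg.card * dg (c.G n) (D l n) x := by
            rw [← Finset.mul_sum]; exact Nat.mul_le_mul_left _ (dg_biUnion_le _ _ _)
          have h2 : ∑ l ∈ Sg, Sg.card * dg (c.G n) (D l n) x < ∑ l ∈ Sg, θ n :=
            Finset.sum_lt_sum_of_nonempty hSg hc
          rw [Finset.sum_const, smul_eq_mul] at h2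
          have := Nat.mul_le_mul_left Sg.card (hn.le.trans hx.2)
          omega)
      obtain ⟨Z, hZ1, hZ2, hZ3⟩ := greedyU (D l) _ (J b) _ Sg.card C θ
        (h0.mono fun n hn => Nat.one_le_iff_ne_zero.2 hn)
        (Eventually.of_forall fun n x hx => (Finset.mem_filter.1 hx).2)
        (Eventually.of_forall fun n j hj y hy => by
          have := (Finset.mem_filter.1 hy).2
          have h1 : dg (c.G n) (D l n) y ≤ d n y :=
            dg_mono (Finset.subset_biUnion_of_mem (fun l => D l n) hl) y
          by_cases h2 : 1 ≤ d n y
          · have : ¬ C * θ n ≤ d n y := fun h => this ⟨h, h2⟩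
            omega
          · omega)
        (Eventually.of_forall fun n j hj => (Finset.card_le_card (Finset.filter_subset _ _)).trans
          ((hT.con hD).card j n)) hXl hY
      refine hg b l hl k hk (Abil.mono (D := D) ⟨Z, hZ1, hZ2.mono' fun n => ?_, fun j hj =>
        (hZ3 j hj).mono' fun n => nn_mono (Finset.filter_subset _ _)⟩ hD.le)
      exact nb_mono subset_rfl ((Finset.filter_subset _ _).trans (Finset.filter_subset _ _))
end Ctx
end TN

namespace TN
open Filter Classical

section Copy
variable {V : Type*} (G : SimpleGraph V) (col : V → ℕ) (δ : ℕ)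

def Kids (R : V → Finset V → Prop) (a : ℕ) (v : V) (C : Finset V) : Prop :=
  ∃ (y : Fin a → V) (Cs : Fin a → Finset V), (∀ b, R (y b) (Cs b)) ∧ (∀ b, G.Adj v (y b)) ∧
    (∀ b, ∀ x ∈ Cs b, x ≠ y b → ¬ G.Adj v x) ∧ (∀ b, ∀ x ∈ Cs b, col x ≠ col v) ∧
    (∀ b b', b ≠ b' → ∀ x ∈ Cs b, ∀ x' ∈ Cs b', ¬ G.Adj x x' ∧ col x ≠ col x') ∧
    C = Finset.univ.biUnion Cs

def IsCopy : ℕ → V → Finset V → Prop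
  | 0, v, C => C = {v}
  | η + 1, v, C => ∃ C', Kids G col (IsCopy η) δ v C' ∧ C = insert v C'

def sz : ℕ → ℕ
  | 0 => 1
  | η + 1 => δ * sz η + 1

variable {G col δ}

lemma IsCopy.mem {η : ℕ} {v : V} {C : Finset V} (h : IsCopy G col δ η v C) : v ∈ C := by
  cases η with
  | zero => rw [IsCopy] at h; simp [h]
  | succ η => obtain ⟨C', -, rfl⟩ := h; simp

lemma IsCopy.card {η : ℕ} {v : V} {C : Finset V} (h : IsCopy G col δ η v C) :
    C.card ≤ sz δ η := by
  induction η generalizing v C with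
  | zero => rw [IsCopy] at h; simp [h, sz]
  | succ η ih =>
    obtain ⟨C', ⟨y, Cs, h1, -, -, -, -, rfl⟩, rfl⟩ := h
    refine (Finset.card_insert_le _ _).trans ?_
    rw [sz]; gcongr
    refine Finset.card_biUnion_le.trans ?_
    refine (Finset.sum_le_card_nsmul _ _ (sz δ η) fun b _ => ih (h1 b)).trans ?_
    simp

lemma Kids.mono {R R' : V → Finset V → Prop} (hR : ∀ v C, R v C → ∃ C' ⊆ C, R' v C') {a : ℕ}
    {v : V} {C : Finset V} (h : Kids G col R a v C) : ∃ C' ⊆ C, Kids G col R' a v C' := by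
  obtain ⟨y, Cs, h1, h2, h3, h4, h5, rfl⟩ := h
  choose Cs' hs hr using fun b => hR _ _ (h1 b)
  refine ⟨_, ?_, y, Cs', hr, h2, fun b x hx => h3 b x (hs b hx), fun b x hx => h4 b x (hs b hx),
    fun b b' hb x hx x' hx' => h5 b b' hb x (hs b hx) x' (hs b' hx'), rfl⟩
  exact Finset.biUnion_mono fun b _ => hs b

lemma IsCopy.trunc {η : ℕ} {v : V} {C : Finset V} (h : IsCopy G col δ (η + 1) v C) :
    ∃ C' ⊆ C, IsCopy G col δ η v C' := by
  induction η generalizing v C with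
  | zero => exact ⟨{v}, by simpa using h.mem, rfl⟩
  | succ η ih =>
    obtain ⟨C', hk, rfl⟩ := h
    obtain ⟨C'', hs, hk'⟩ := hk.mono (fun v C hR => ih hR)
    exact ⟨insert v C'', Finset.insert_subset_insert _ hs, C'', hk', rfl⟩

lemma Kids.le {R : V → Finset V → Prop} {a a' : ℕ} (ha : a' ≤ a) {v : V} {C : Finset V}
    (h : Kids G col R a v C) : ∃ C' ⊆ C, Kids G col R a' v C' := by
  obtain ⟨y, Cs, h1, h2, h3, h4, h5, rfl⟩ := h
  refine ⟨_, ?_, fun b => y (Fin.castLE ha b), fun b => Cs (Fin.castLE ha b), fun b => h1 _,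
    fun b => h2 _, fun b => h3 _, fun b => h4 _, fun b b' hb => h5 _ _ ?_, rfl⟩
  · intro x; simp only [Finset.mem_biUnion, Finset.mem_univ, true_and]
    rintro ⟨b, hb⟩; exact ⟨_, hb⟩
  · exact fun e => hb (Fin.castLE_injective ha e)

lemma Kids.zero (R : V → Finset V → Prop) (v : V) : Kids G col R 0 v ∅ :=
  ⟨Fin.elim0, Fin.elim0, fun b => b.elim0, fun b => b.elim0, fun b => b.elim0, fun b => b.elim0,
    fun b => b.elim0, by simp⟩

lemma Kids.snoc {R : V → Finset V → Prop} {a : ℕ} {v y : V} {C C2 : Finset V}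
    (h : Kids G col R a v C) (hR : R y C2) (hy : G.Adj v y) (hv : ∀ x ∈ C2, x ≠ y → ¬ G.Adj v x)
    (hc : ∀ x ∈ C2, col x ≠ col v) (hCC : ∀ x ∈ C, ∀ x' ∈ C2, ¬ G.Adj x x' ∧ col x ≠ col x') :
    Kids G col R (a + 1) v (C ∪ C2) := by
  obtain ⟨ys, Cs, h1, h2, h3, h4, h5, rfl⟩ := h
  refine ⟨Fin.snoc (α := fun _ => V) ys y, Fin.snoc (α := fun _ => Finset V) Cs C2, ?_, ?_, ?_, ?_, ?_, ?_⟩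
  · intro b; refine Fin.lastCases ?_ (fun b => ?_) b <;> simp_all
  · intro b; refine Fin.lastCases ?_ (fun b => ?_) b <;> simp_all
  · intro b; refine Fin.lastCases ?_ (fun b => ?_) b
    · simpa using hv
    · simpa using h3 b
  · intro b; refine Fin.lastCases ?_ (fun b => ?_) b
    · simpa using hc
    · simpa using h4 b
  · have hmem : ∀ b, ∀ x ∈ Cs b, x ∈ Finset.univ.biUnion Cs := fun b x hx => by
      simp only [Finset.mem_biUnion, Finset.mem_univ, true_and]; exact ⟨b, hx⟩
    intro b b'
    refine Fin.lastCases ?_ (fun b => ?_) b <;> refine Fin.lastCases ?_ (fun b' => ?_) b'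
    · intro h; exact absurd rfl h
    · intro _ x hx x' hx'
      simp only [Fin.snoc_last, Fin.snoc_castSucc] at hx hx'
      have := hCC x' (hmem _ _ hx') x hx
      exact ⟨fun h => this.1 h.symm, this.2.symm⟩
    · intro _ x hx x' hx'
      simp only [Fin.snoc_last, Fin.snoc_castSucc] at hx hx'
      exact hCC x (hmem _ _ hx) x' hx'
    · intro hb
      simpa using h5 b b' (fun e => hb (by rw [e]))
  · ext x
    simp only [Finset.mem_union, Finset.mem_biUnion, Finset.mem_univ, true_and]
    constructor
    · rintro (⟨b, hb⟩ | h)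
      · exact ⟨b.castSucc, by simpa using hb⟩
      · exact ⟨Fin.last a, by simpa using h⟩
    · rintro ⟨b, hb⟩
      revert hb
      refine Fin.lastCases ?_ (fun b => ?_) b
      · intro h; right; simpa using h
      · intro h; left; exact ⟨b, by simpa using h⟩

lemma IsCopy.words {η : ℕ} {v : V} {C : Finset V} (h : IsCopy G col δ η v C) :
    ∃ φ : List (Fin δ) → V, φ [] = v ∧ (∀ w, w.length ≤ η → φ w ∈ C) ∧
      ∀ w w', w.length ≤ η → w'.length ≤ η → (col (φ w) = col (φ w') → w = w') ∧
        (G.Adj (φ w) (φ w') ↔ (∃ b, w' = w ++ [b]) ∨ ∃ b, w = w' ++ [b]) := by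
  induction η generalizing v C with
  | zero =>
    rw [IsCopy] at h
    refine ⟨fun _ => v, rfl, by simp [h], fun w w' hw hw' => ?_⟩
    simp only [Nat.le_zero, List.length_eq_zero_iff] at hw hw'
    subst hw; subst hw'; simp
  | succ η ih =>
    obtain ⟨C', ⟨y, Cs, h1, h2, h3, h4, h5, rfl⟩, rfl⟩ := h
    choose φ e m p using fun b => ih (h1 b)
    refine ⟨fun w => match w with
      | [] => v
      | b :: w => φ b w, rfl, ?_, ?_⟩
    · rintro (_ | ⟨b, w⟩) hw
      · simp
      · simp only [Finset.mem_insert, Finset.mem_biUnion, Finset.mem_univ, true_and]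
        exact Or.inr ⟨b, m b w (by simpa using hw)⟩
    · have hroot : ∀ b w, w.length ≤ η → (G.Adj v (φ b w) ↔ w = []) := by
        intro b w hw
        constructor
        · intro hadj
          by_contra hne
          have : φ b w ≠ y b := by
            intro e'
            exact hne ((p b w [] hw (by simp)).1 (by rw [e', e]))
          exact h3 b _ (m b w hw) this hadj
        · rintro rfl; rw [e]; exact h2 b
      rintro (_ | ⟨b, w⟩) (_ | ⟨b', w'⟩) hw hw'
      · simp
      · have hw' : w'.length ≤ η := by simpa using hw'
        refine ⟨fun h => absurd h.symm (h4 b' _ (m b' w' hw')), ?_⟩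
        simp only [hroot b' w' hw']
        simp
      · have hw : w.length ≤ η := by simpa using hw
        refine ⟨fun h => absurd h (h4 b _ (m b w hw)), ?_⟩
        simp only [G.adj_comm _ v, hroot b w hw]
        simp
      · have hw : w.length ≤ η := by simpa using hw
        have hv' : w'.length ≤ η := by simpa using hw'
        by_cases hb : b = b'
        · subst hb
          have := p b w w' hw hv'
          simpa using this
        · have := h5 b b' hb _ (m b w hw) _ (m b' w' hv')
          refine ⟨fun h => absurd h this.2, ?_⟩
          simp only [this.1, false_iff]
          simp [hb, Ne.symm hb]

lemma tree_words {t : ℕ} {T : SimpleGraph (Fin t)} (hT : T.IsTree) :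
    ∃ w : Fin t → List (Fin t), (∀ u, (w u).length ≤ t) ∧ Function.Injective w ∧
      ∀ u u', T.Adj u u' ↔ (∃ b, w u' = w u ++ [b]) ∨ ∃ b, w u = w u' ++ [b] := by
  obtain ⟨r⟩ := hT.1.nonempty
  choose p hp hpu using fun u => hT.existsUnique_path r u
  have hs : ∀ u, (p u).support = r :: (p u).support.tail := fun u =>
    (p u).cons_tail_support.symm
  have hlast : ∀ u, (p u).support.getLast (by simp) = u := fun u => (p u).getLast_support
  refine ⟨fun u => (p u).support.tail, fun u => ?_, fun u u' h => ?_, fun u u' => ?_⟩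
  · have := (hp u).length_lt
    simp at this ⊢; omega
  · have : (p u).support = (p u').support := by rw [hs u, hs u']; simp only at h; rw [h]
    rw [← hlast u, ← hlast u']; simp only [this]
  · have key : ∀ u u', T.Adj u u' → u' ∉ (p u).support →
        (p u').support.tail = (p u).support.tail ++ [u'] := by
      intro u u' ha hn
      have := hpu u' ((p u).concat ha) ((hp u).concat hn ha)
      rw [← this, SimpleGraph.Walk.support_concat]
      rw [hs u]; simp
    have key2 : ∀ u u' b, (p u').support.tail = (p u).support.tail ++ [b] → T.Adj u u' := by
      intro u u' b h
      have e : (p u').support = (p u).support ++ [b] := by rw [hs u', h, ← List.cons_append, ← hs u]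
      have hb : b = u' := by
        rw [← hlast u']; simp only [e]; simp
      have hch := (p u').isChain_adj_support
      rw [e, List.isChain_append] at hch
      have := hch.2.2 u (by rw [List.getLast?_eq_some_getLast (by simp)]; simp) b (by simp)
      rwa [← hb]
    constructor
    · intro ha
      by_cases h1 : u' ∈ (p u).support
      · right
        refine ⟨u, key u' u ha.symm fun h2 => ?_⟩
        have e1 := hpu u' ((p u).takeUntil u' h1) ((hp u).takeUntil h1)
        have e2 := hpu u ((p u').takeUntil u h2) ((hp u').takeUntil h2)
        have l1 := (p u).length_takeUntil_lt_length h1 ha.ne'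
        have l2 := (p u').length_takeUntil_lt_length h2 ha.ne
        rw [e1] at l1; rw [e2] at l2; omega
      · exact Or.inl ⟨u', key u u' ha h1⟩
    · rintro (⟨b, h⟩ | ⟨b, h⟩)
      · exact key2 _ _ _ h
      · exact (key2 _ _ _ h).symm

lemma IsCopy.tree {t : ℕ} {T : SimpleGraph (Fin t)} (hT : T.IsTree) {v : V} {C : Finset V}
    (h : IsCopy G col t t v C) : ∃ f : Fin t → V, (∀ u, f u ∈ C) ∧
      (∀ u u', col (f u) = col (f u') → u = u') ∧ ∀ u u', T.Adj u u' ↔ G.Adj (f u) (f u') := by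
  obtain ⟨φ, -, hm, hφ⟩ := h.words
  obtain ⟨w, hl, hi, ha⟩ := tree_words hT
  exact ⟨fun u => φ (w u), fun u => hm _ (hl u),
    fun u u' h => hi ((hφ _ _ (hl u) (hl u')).1 h),
    fun u u' => (ha u u').trans (hφ _ _ (hl u) (hl u')).2.symm⟩
end Copy
end TN

namespace TN
open Filter Classical
namespace Ctx
variable {c : Ctx} {ι : Type*}

def Ex (D0 : ι → c.ISet) (δ η : ℕ) (L K : Set ι) : Prop :=
  ∀ D, Con D0 D → ∀ᶠ n in c.U, ∃ l ∈ L, ∃ v ∈ D l n, ∃ C, IsCopy (c.G n) (c.col n) δ η v C ∧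
    ∀ x ∈ C, x ≠ v → ∃ k ∈ K, x ∈ D k n

def Rt (D D' : ι → c.ISet) (δ η : ℕ) (r : ι) (A Q : Set ι) : Prop :=
  ∀ᶠ n in c.U, ∀ v ∈ D' r n, ∃ C, IsCopy (c.G n) (c.col n) δ η v C ∧
    ∀ x ∈ C, x ≠ v → (∃ i ∈ A, x ∈ D i n) ∧ ∀ q ∈ Q, ∀ z ∈ D' q n, ¬ (c.G n).Adj x z

def Chd (D D' : ι → c.ISet) (δ η : ℕ) (r : ι) (A Q : Set ι) : Prop :=
  ∀ᶠ n in c.U, ∀ v ∈ D' r n, ∃ y C, IsCopy (c.G n) (c.col n) δ η y C ∧ (c.G n).Adj v y ∧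
    (∀ x ∈ C, x ≠ y → ¬ (c.G n).Adj v x) ∧
    ∀ x ∈ C, (∃ i ∈ A, x ∈ D i n) ∧ ∀ q ∈ Q, ∀ z ∈ D' q n, ¬ (c.G n).Adj x z

def KidsAt (D D' : ι → c.ISet) (δ η : ℕ) (r : ι) (a : ℕ) (A Q : Set ι) : Prop :=
  ∀ᶠ n in c.U, ∀ v ∈ D' r n, ∃ C, Kids (c.G n) (c.col n) (IsCopy (c.G n) (c.col n) δ η) a v C ∧
    ∀ x ∈ C, (∃ i ∈ A, x ∈ D i n) ∧ ∀ q ∈ Q, ∀ z ∈ D' q n, ¬ (c.G n).Adj x z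

variable {D0 D D' D1 D2 : ι → c.ISet} {δ η a : ℕ} {r : ι} {A A2 Q Q1 Q2 : Set ι}

lemma Con.refl (h : ∀ i, Big (D i)) : Con D D := ⟨fun _ _ => subset_rfl, h⟩

lemma Rt.zero : Rt D D' δ 0 r A Q :=
  Eventually.of_forall fun n v hv => ⟨{v}, rfl, fun x hx hne => absurd (by simpa using hx) hne⟩

lemma KidsAt.zero : KidsAt D D' δ η r 0 A Q :=
  Eventually.of_forall fun n v hv => ⟨∅, Kids.zero _ _, fun x hx => by simp at hx⟩

lemma KidsAt.step (hT : Tok D) (h01 : ∀ i n, D1 i n ⊆ D i n) (h12 : ∀ i n, D2 i n ⊆ D1 i n)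
    (h1 : KidsAt D D1 δ η r a A Q1) (h2 : Chd D1 D2 δ η r A2 Q2)
    (hA2 : A2 ⊆ Q1) (hQ : Q2 ⊆ Q1) (hd : ∀ i ∈ A, i ∉ A2) (hr : r ∉ A2) :
    KidsAt D D2 δ η r (a + 1) (A ∪ A2) Q2 := by
  filter_upwards [h1, h2] with n h1 h2 v hv
  obtain ⟨C, hk, hC⟩ := h1 v (h12 _ _ hv)
  obtain ⟨y, C2, hc, hvy, hvn, hC2⟩ := h2 v hv
  refine ⟨C ∪ C2, hk.snoc hc hvy hvn ?_ ?_, ?_⟩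
  · intro x hx
    obtain ⟨⟨i, hi, hxi⟩, -⟩ := hC2 x hx
    exact hT.sep i r (fun e => hr (e ▸ hi)) n x (h01 _ _ hxi) v (h01 _ _ (h12 _ _ hv))
  · intro x hx x' hx'
    obtain ⟨⟨i, hi, hxi⟩, -⟩ := hC2 x' hx'
    obtain ⟨⟨j, hj, hxj⟩, hn⟩ := hC x hx
    exact ⟨hn i (hA2 hi) _ hxi, hT.sep j i (fun e => hd j hj (e ▸ hi)) n x hxj x' (h01 _ _ hxi)⟩
  · intro x hx
    rcases Finset.mem_union.1 hx with hx | hx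
    · obtain ⟨⟨j, hj, hxj⟩, hn⟩ := hC x hx
      exact ⟨⟨j, Or.inl hj, hxj⟩, fun q hq z hz => hn q (hQ hq) z (h12 _ _ hz)⟩
    · obtain ⟨⟨j, hj, hxj⟩, hn⟩ := hC2 x hx
      exact ⟨⟨j, Or.inr hj, h01 _ _ hxj⟩, hn⟩

lemma KidsAt.mono (h : KidsAt D D1 δ η r a A Q) (h12 : ∀ i n, D2 i n ⊆ D1 i n)
    (hA : A ⊆ A2) (hQ : Q2 ⊆ Q) : KidsAt D D2 δ η r a A2 Q2 := by
  filter_upwards [h] with n h v hv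
  obtain ⟨C, hk, hC⟩ := h v (h12 _ _ hv)
  refine ⟨C, hk, fun x hx => ?_⟩
  obtain ⟨⟨j, hj, hxj⟩, hn⟩ := hC x hx
  exact ⟨⟨j, hA hj, hxj⟩, fun q hq z hz => hn q (hQ hq) z (h12 _ _ hz)⟩

lemma KidsAt.rt (h : KidsAt D D' δ η r a A Q) (ha : δ ≤ a) : Rt D D' δ (η + 1) r A Q := by
  filter_upwards [h] with n h v hv
  obtain ⟨C, hk, hC⟩ := h v hv
  obtain ⟨C', hs, hk'⟩ := hk.le ha
  refine ⟨insert v C', ⟨C', hk', rfl⟩, fun x hx hne => ?_⟩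
  exact hC x (hs (by simpa [hne] using hx))

lemma Rt.mono (h : Rt D D1 δ η r A Q) (h12 : ∀ i n, D2 i n ⊆ D1 i n)
    (hA : A ⊆ A2) (hQ : Q2 ⊆ Q) : Rt D D2 δ η r A2 Q2 := by
  filter_upwards [h] with n h v hv
  obtain ⟨C, hk, hC⟩ := h v (h12 _ _ hv)
  refine ⟨C, hk, fun x hx hne => ?_⟩
  obtain ⟨⟨j, hj, hxj⟩, hn⟩ := hC x hx hne
  exact ⟨⟨j, hA hj, hxj⟩, fun q hq z hz => hn q (hQ hq) z (h12 _ _ hz)⟩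

lemma Rt.base (h : Rt D1 D2 δ η r A Q) (h01 : ∀ i n, D1 i n ⊆ D i n) : Rt D D2 δ η r A Q := by
  filter_upwards [h] with n h v hv
  obtain ⟨C, hk, hC⟩ := h v hv
  refine ⟨C, hk, fun x hx hne => ?_⟩
  obtain ⟨⟨j, hj, hxj⟩, hn⟩ := hC x hx hne
  exact ⟨⟨j, hj, h01 _ _ hxj⟩, hn⟩

lemma Rt.trunc (h : Rt D D1 δ (η + 1) r A Q) : Rt D D1 δ η r A Q := by
  filter_upwards [h] with n h v hv
  obtain ⟨C, hk, hC⟩ := h v hv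
  obtain ⟨C', hs, hk'⟩ := hk.trunc
  exact ⟨C', hk', fun x hx hne => hC x (hs hx) hne⟩

lemma ex_of_rt {L K : Set ι} (h : ∀ D, Con D0 D → ∃ D', Con D D' ∧ ∃ r ∈ L, Rt D D' δ η r K ∅) :
    Ex D0 δ η L K := by
  intro D hD
  obtain ⟨D', hD', r, hr, hrt⟩ := h D hD
  filter_upwards [hrt, (hD'.big r).nonempty] with n h1 ⟨v, hv⟩
  obtain ⟨C, hk, hC⟩ := h1 v hv
  exact ⟨r, hr, v, hD'.le _ _ hv, C, hk, fun x hx hne => (hC x hx hne).1⟩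

lemma Ex.mono {L K L' K' : Set ι} (h : Ex D0 δ η L K) (hL : L ⊆ L') (hK : K ⊆ K') :
    Ex D0 δ η L' K' := by
  intro D hD
  filter_upwards [h D hD] with n ⟨l, hl, v, hv, C, hC, hx⟩
  exact ⟨l, hL hl, v, hv, C, hC, fun x h1 h2 => by
    obtain ⟨k, hk, h3⟩ := hx x h1 h2; exact ⟨k, hK hk, h3⟩⟩

lemma push (hst : Stable D0) (hD : Con D0 D) (hD1 : Con D D1) {t : ι}
    (hrt : Rt D D1 δ η t A Q1) (hr : r ∈ Q1) (hQ : Q ⊆ Q1) (hrQ : r ∉ Q)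
    (hab : Abil D0 t r Q) : ∃ D2, Con D1 D2 ∧ Chd D D2 δ η r (insert t A) Q := by
  obtain ⟨X, hX1, hX2, hX3⟩ := hst.stab D1 (hD.trans hD1) _ _ _ hab
  let D2 : ι → c.ISet := fun i n => if i = r then nb (c.G n) (X n) (D1 r n) else
    if i ∈ Q then nn (c.G n) (X n) (D1 i n) else D1 i n
  have er : ∀ n, D2 r n = nb (c.G n) (X n) (D1 r n) := fun n => by simp [D2]
  have eq : ∀ q ∈ Q, ∀ n, D2 q n = nn (c.G n) (X n) (D1 q n) := fun q hq n => by
    have : q ≠ r := fun e => hrQ (e ▸ hq)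
    simp [D2, this, hq]
  have hle : ∀ i n, D2 i n ⊆ D1 i n := by
    intro i n
    simp only [D2]
    split_ifs with h1 h2
    · subst h1; exact nb_sub _ _
    · exact nn_sub _ _
    · exact subset_rfl
  refine ⟨D2, ⟨hle, fun i => ?_⟩, ?_⟩
  · by_cases h1 : i = r
    · subst h1; exact hX2.mono' fun n => (er n).ge
    · by_cases h2 : i ∈ Q
      · exact (hX3 i h2).mono' fun n => (eq i h2 n).ge
      · exact (hD1.big i).mono' fun n => by simp [D2, h1, h2]
  · filter_upwards [hrt] with n hrt v hv
    rw [er, mem_nb] at hv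
    obtain ⟨hv1, x, hxX, hxv⟩ := hv
    obtain ⟨C, hk, hC⟩ := hrt x (hX1 n hxX)
    refine ⟨x, C, hk, hxv.symm, fun z hz hne h => (hC z hz hne).2 r hr v hv1 h.symm, ?_⟩
    intro z hz
    by_cases hne : z = x
    · subst hne
      refine ⟨⟨t, Or.inl rfl, hD1.le _ _ (hX1 n hxX)⟩, fun q hq w hw => ?_⟩
      rw [eq q hq, mem_nn] at hw
      exact hw.2 _ hxX
    · obtain ⟨⟨i, hi, hi'⟩, h2⟩ := hC z hz hne
      exact ⟨⟨i, Or.inr hi, hi'⟩, fun q hq w hw => h2 q (hQ hq) w (hle _ _ hw)⟩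
end Ctx
end TN

namespace TN
open Filter Classical

lemma nb_card_le {V : Type*} {G : SimpleGraph V} {X D : Finset V} {k : ℕ}
    (h : ∀ x ∈ X, dg G D x ≤ k) : (nb G X D).card ≤ X.card * k := by
  have : nb G X D ⊆ X.biUnion (fun x => D.filter (fun u => G.Adj x u)) := by
    intro v; simp only [mem_nb, Finset.mem_biUnion, Finset.mem_filter]
    rintro ⟨a, x, b, e⟩; exact ⟨x, b, a, e⟩
  refine (Finset.card_le_card this).trans (Finset.card_biUnion_le.trans ?_)
  rw [← smul_eq_mul]; exact Finset.sum_le_card_nsmul _ _ _ h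

lemma incr {V : Type*} {G : SimpleGraph V} {E0 C A c : Finset V} {y : V} {θ S : ℕ}
    (hc : c.card ≤ S) (h4 : 4 * S * θ ≤ dg G (nn G C E0) y)
    (h1 : 1 ≤ dg G (nn G C E0) y) (hlow : ∀ x ∈ c, x ≠ y → dg G (nn G C E0) x ≤ θ)
    (hA : A ⊆ nb G C E0) (hA2 : (nb G C E0).card ≤ 2 * A.card) :
    ∃ A1 ⊆ E0, (∀ v ∈ A1, G.Adj v y ∧ ∀ x ∈ c, x ≠ y → ¬ G.Adj v x) ∧
      A.card < (A ∪ A1).card ∧ (nb G (C ∪ c) E0).card ≤ 2 * (A ∪ A1).card := by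
  set E := nn G C E0 with hE
  set A1 := E.filter (fun v => G.Adj v y ∧ ∀ x ∈ c, x ≠ y → ¬ G.Adj v x) with hA1
  have hrest : (nb G (c.erase y) E).card ≤ S * θ := by
    refine (nb_card_le (k := θ) ?_).trans (Nat.mul_le_mul_right _
      ((Finset.card_erase_le).trans hc))
    intro x hx; rw [Finset.mem_erase] at hx; exact hlow x hx.2 hx.1
  have e1 : dg G E y ≤ A1.card + (nb G (c.erase y) E).card := by
    refine le_trans (Finset.card_le_card ?_) (Finset.card_union_le _ _)
    intro v
    simp only [hA1, Finset.mem_filter, Finset.mem_union, mem_nb, Finset.mem_erase]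
    rintro ⟨a, b⟩
    by_cases h : ∃ x ∈ c, x ≠ y ∧ G.Adj v x
    · obtain ⟨x, p, q, r⟩ := h; exact Or.inr ⟨a, x, ⟨q, p⟩, r.symm⟩
    · push Not at h; exact Or.inl ⟨a, b.symm, h⟩
  have e2 : (nb G c E).card ≤ dg G E y + (nb G (c.erase y) E).card := by
    rw [← nb_singleton]
    refine le_trans (Finset.card_le_card (nb_mono ?_ subset_rfl)) (nb_union_card _ _ _)
    intro x hx; by_cases h : x = y <;> simp [h, hx]
  have e3 : (nb G (C ∪ c) E0).card ≤ (nb G C E0).card + (nb G c E).card := by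
    refine le_trans (Finset.card_le_card ?_) (Finset.card_union_le _ _)
    intro v
    simp only [hE, mem_nb, mem_nn, Finset.mem_union]
    grind
  have e4 : (A ∪ A1).card = A.card + A1.card := by
    apply Finset.card_union_of_disjoint
    rw [Finset.disjoint_left]; intro v hv hv'
    have a := hA hv
    simp only [hA1, hE, mem_nb, mem_nn, Finset.mem_filter] at a hv'
    grind
  have h4' : 4 * (S * θ) ≤ dg G E y := by rw [← mul_assoc]; exact h4
  refine ⟨A1, (Finset.filter_subset _ _).trans (nn_sub _ _), fun v hv => ?_, ?_, ?_⟩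
  · exact (Finset.mem_filter.1 hv).2
  · omega
  · omega

namespace Ctx
variable {c : Ctx} {ι : Type*}

lemma composite [Finite ι] {D0 : ι → c.ISet} {δ η : ℕ} (hst : Stable D0) (Sg U Q : Finset ι)
    (hSg : Sg.Nonempty) (hSU : ∀ i ∈ Sg, i ∉ U) (hSQ : ∀ i ∈ Sg, i ∉ Q)
    (hserv : ∀ i ∈ U, ∀ q ∈ Q, ¬ Abil D0 i q {j | (j ∈ Sg ∨ j ∈ Q) ∧ j ≠ q})
    {h : ℕ} (J : Fin h → Finset ι) (K : Finset ι) (hJ : ∀ b, (J b).Nonempty)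
    (hJU : ∀ b, J b ⊆ U) (hKU : K ⊆ U) (hJK : ∀ b, ∀ j ∈ J b, j ∉ K)
    (hgap : ∀ b, ∀ l ∈ Sg, ∀ k ∈ K, ¬ Abil D0 l k (J b : Set ι))
    (hEx : ∀ j : Fin h → ι, (∀ b, j b ∈ J b) → Ex D0 δ η (Set.range j) (K : Set ι))
    (D : ι → c.ISet) (hD : Con D0 D) :
    ∃ l ∈ Sg, ∃ D', Con D D' ∧ Chd D D' δ η l (U : Set ι) {q | (q ∈ Sg ∧ q ≠ l) ∨ q ∈ Q} := by
  cases nonempty_fintype ι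
  obtain ⟨m, hm0, hm⟩ := Big.common Finset.univ (F := D) (fun i _ => hD.big i)
  set DS : c.ISet := fun n => Sg.biUnion (fun i => D i n) with hDS
  set DU : c.ISet := fun n => U.biUnion (fun i => D i n) with hDU
  let P : ∀ n, Finset (c.V n) → Finset (c.V n) → Prop := fun n C A =>
    C ⊆ DU n ∧ A ⊆ DS n ∧
    (∀ v ∈ A, ∃ y e, IsCopy (c.G n) (c.col n) δ η y e ∧ e ⊆ C ∧ (c.G n).Adj v y ∧
      ∀ x ∈ e, x ≠ y → ¬ (c.G n).Adj v x) ∧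
    (nb (c.G n) C (DS n)).card ≤ 2 * A.card ∧
    ∀ s, (s ∈ Sg ∨ s ∈ Q) → 2 * m * (nb (c.G n) C (D s n)).card ≤ c.W n
  have hmax : ∀ n, ∃ C A, P n C A ∧ ∀ C' A', P n C' A' → A'.card ≤ A.card := by
    intro n
    let F := ((DU n).powerset ×ˢ (DS n).powerset).filter (fun p => P n p.1 p.2)
    have hF : F.Nonempty := by
      refine ⟨(∅, ∅), ?_⟩
      refine Finset.mem_filter.2 ⟨by simp, ?_⟩
      simp [P, nb]
    obtain ⟨p, hp, hpm⟩ := Finset.exists_max_image F (fun p => p.2.card) hF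
    refine ⟨p.1, p.2, (Finset.mem_filter.1 hp).2, fun C' A' h' => hpm (C', A') ?_⟩
    simp only [F, Finset.mem_filter, Finset.mem_product, Finset.mem_powerset]
    exact ⟨⟨h'.1, h'.2.1⟩, h'⟩
  choose C A hP hPmax using hmax
  have hnn : ∀ s, (s ∈ Sg ∨ s ∈ Q) → Big (fun n => nn (c.G n) (C n) (D s n)) := by
    intro s hs
    refine ⟨2 * m, ?_⟩
    filter_upwards [hm] with n hn
    have h1 := (hP n).2.2.2.2 s hs
    have h2 := nb_add_nn (G := c.G n) (C n) (D s n)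
    have h3 := hn s (Finset.mem_univ _)
    rw [← h2] at h3
    nlinarith
  have hAC : ∀ n, A n ⊆ nb (c.G n) (C n) (DS n) := by
    intro n v hv
    obtain ⟨y, e, he, hec, hvy, -⟩ := (hP n).2.2.1 v hv
    rw [mem_nb]
    exact ⟨(hP n).2.1 hv, y, hec he.mem, hvy.symm⟩
  have hex : ∃ s, (s ∈ Sg ∨ s ∈ Q) ∧ Big (fun n => nb (c.G n) (C n) (D s n)) := by
    by_contra hcon
    push Not at hcon
    let D1 : ι → c.ISet := fun s n => if s ∈ Sg then nn (c.G n) (C n) (D s n) else D s n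
    have e1 : ∀ s ∈ Sg, ∀ n, D1 s n = nn (c.G n) (C n) (D s n) := fun s hs n => by simp [D1, hs]
    have hD1 : Con D D1 := by
      constructor
      · intro i n; simp only [D1]; split_ifs
        · exact nn_sub _ _
        · exact subset_rfl
      · intro i
        by_cases hi : i ∈ Sg
        · exact (hnn i (Or.inl hi)).mono' fun n => (e1 i hi n).ge
        · exact (hD.big i).mono' fun n => by simp [D1, hi]
    obtain ⟨θ, hθ1, hθ2⟩ := gap hst.tok (hD.trans hD1) Sg K J hSg hJ
      (fun b => Finset.disjoint_left.2 fun i hi hj => hSU i hi (hJU b hj)) hgap (4 * sz δ η)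
    choose j hjJ hjB using hθ2
    set d : ∀ n, c.V n → ℕ := fun n x => dg (c.G n) (Sg.biUnion (fun l => D1 l n)) x with hd
    let D2 : ι → c.ISet := fun i n => if ∃ b, j b = i then
      (D1 i n).filter (fun y => 4 * sz δ η * θ n ≤ d n y ∧ 1 ≤ d n y) else
      if i ∈ K then (D1 i n).filter (fun x => d n x ≤ θ n) else D1 i n
    have hD2 : Con D1 D2 := by
      constructor
      · intro i n; simp only [D2]; split_ifs
        · exact Finset.filter_subset _ _
        · exact Finset.filter_subset _ _
        · exact subset_rfl
      · intro i
        by_cases hi : ∃ b, j b = i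
        · obtain ⟨b, rfl⟩ := hi
          refine (hjB b).mono' fun n => ?_
          have : ∃ b', j b' = j b := ⟨b, rfl⟩
          simp only [D2, if_pos this]; intro x; simp [hd]
        · by_cases hk : i ∈ K
          · refine (hθ1 i hk).mono' fun n => ?_
            simp only [D2, if_neg hi, if_pos hk]; intro x; simp [hd]
          · refine (hD1.big i).mono' fun n => ?_
            simp [D2, hi, hk]
    have hE := hEx j hjJ D2 ((hD.trans hD1).trans hD2)
    have hsmall : ∀ᶠ n in c.U, ∀ s ∈ (Finset.univ : Finset ι), (s ∈ Sg ∨ s ∈ Q) →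
        4 * m * (nb (c.G n) (C n) (D s n)).card < c.W n := by
      rw [Filter.eventually_all_finset]
      intro s _
      by_cases hs : s ∈ Sg ∨ s ∈ Q
      · filter_upwards [not_big.1 (hcon s hs) (4 * m)] with n hn _ using hn
      · exact Eventually.of_forall fun n h => absurd h hs
    obtain ⟨n, ⟨l, ⟨b, rfl⟩, y, hy, e, he, hx⟩, hs, hdeg⟩ :=
      (hE.and (hsmall.and (c.hdeg (4 * m * sz δ η)))).exists
    have hEq : Sg.biUnion (fun l => D1 l n) = nn (c.G n) (C n) (DS n) := by
      ext v
      simp only [Finset.mem_biUnion, mem_nn, hDS]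
      constructor
      · rintro ⟨l, hl, hv⟩
        rw [e1 l hl, mem_nn] at hv
        exact ⟨⟨l, hl, hv.1⟩, hv.2⟩
      · rintro ⟨⟨l, hl, hv⟩, h2⟩
        exact ⟨l, hl, by rw [e1 l hl, mem_nn]; exact ⟨hv, h2⟩⟩
    have hyb : ∃ b', j b' = j b := ⟨b, rfl⟩
    have hyD : y ∈ D (j b) n := hD1.le _ _ (hD2.le _ _ hy)
    simp only [D2, if_pos hyb, Finset.mem_filter, hd, hEq] at hy
    have hxK : ∀ x ∈ e, x ≠ y → ∃ k ∈ K, x ∈ D k n ∧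
        dg (c.G n) (nn (c.G n) (C n) (DS n)) x ≤ θ n := by
      intro x hxe hne
      obtain ⟨k, hk, hxk⟩ := hx x hxe hne
      refine ⟨k, hk, hD1.le _ _ (hD2.le _ _ hxk), ?_⟩
      have hkj : ¬ ∃ b', j b' = k := by
        rintro ⟨b', rfl⟩; exact hJK b' _ (hjJ b') hk
      have hk' : k ∈ K := hk
      simp only [D2, if_neg hkj, if_pos hk', Finset.mem_filter, hd, hEq] at hxk
      exact hxk.2
    obtain ⟨A1, hA1, hA1v, hlt, hnb⟩ := incr he.card hy.2.1 hy.2.2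
      (fun x hxe hne => by obtain ⟨k, -, -, h⟩ := hxK x hxe hne; exact h) (hAC n) (hP n).2.2.2.1
    have hnew : P n (C n ∪ e) (A n ∪ A1) := by
      refine ⟨Finset.union_subset (hP n).1 ?_, Finset.union_subset (hP n).2.1 hA1, ?_, hnb, ?_⟩
      · intro x hxe
        simp only [hDU, Finset.mem_biUnion]
        by_cases hne : x = y
        · subst hne; exact ⟨j b, hJU b (hjJ b), hyD⟩
        · obtain ⟨k, hk, h1, -⟩ := hxK x hxe hne
          exact ⟨k, hKU hk, h1⟩
      · intro v hv
        rcases Finset.mem_union.1 hv with hv | hv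
        · obtain ⟨y', e', h1, h2, h3, h4⟩ := (hP n).2.2.1 v hv
          exact ⟨y', e', h1, h2.trans Finset.subset_union_left, h3, h4⟩
        · exact ⟨y, e, he, Finset.subset_union_right, hA1v v hv⟩
      · intro s hsS
        have h1 := hs s (Finset.mem_univ _) hsS
        have h2 : 4 * m * (nb (c.G n) e (D s n)).card ≤ c.W n := by
          let k := e.sup (fun x => dg (c.G n) (D s n) x)
          have h3 : (nb (c.G n) e (D s n)).card ≤ e.card * k :=
            nb_card_le fun x hx => Finset.le_sup (f := fun x => dg (c.G n) (D s n) x) hx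
          obtain ⟨x, -, hxk⟩ := Finset.exists_mem_eq_sup e ⟨y, he.mem⟩
            (fun x => dg (c.G n) (D s n) x)
          have h4 := hdeg x (D s n)
          have h5 : e.card * k ≤ sz δ η * dg (c.G n) (D s n) x := by
            simp only [k, hxk]; exact Nat.mul_le_mul_right _ he.card
          calc _ ≤ 4 * m * (sz δ η * dg (c.G n) (D s n) x) := Nat.mul_le_mul_left _ (h3.trans h5)
            _ = 4 * m * sz δ η * dg (c.G n) (D s n) x := by ring
            _ ≤ _ := h4.le
        have h3 := nb_union_card (G := c.G n) (C n) e (D s n)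
        have h4 := Nat.mul_le_mul_left (2 * m) h3
        have e5 : 4 * m * (nb (c.G n) (C n) (D s n)).card =
          2 * (2 * m * (nb (c.G n) (C n) (D s n)).card) := by ring
        have e6 : 4 * m * (nb (c.G n) e (D s n)).card =
          2 * (2 * m * (nb (c.G n) e (D s n)).card) := by ring
        rw [mul_add] at h4
        omega
    have := hPmax n _ _ hnew
    omega
  obtain ⟨s, hs, hsB⟩ := hex
  by_cases hsQ : s ∈ Q
  · exfalso
    obtain ⟨i, hi, hiB⟩ := hsB.biUnion (s := U)
      (F := fun i n => nb (c.G n) (C n ∩ D i n) (D s n)) (Eventually.of_forall fun n v hv => by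
        rw [mem_nb] at hv
        obtain ⟨h1, x, hx, hxv⟩ := hv
        have := (hP n).1 hx
        simp only [hDU, Finset.mem_biUnion] at this
        obtain ⟨i, hi, hxi⟩ := this
        simp only [Finset.mem_biUnion, mem_nb, Finset.mem_inter]
        exact ⟨i, hi, h1, x, ⟨hx, hxi⟩, hxv⟩)
    refine hserv i hi s hsQ (Abil.mono (D := D) ⟨fun n => C n ∩ D i n,
      fun n => Finset.inter_subset_right, hiB, fun j hj => (hnn j hj.1).mono' fun n v => ?_⟩ hD.le)
    simp only [mem_nn, Finset.mem_inter]
    rintro ⟨h1, h2⟩; exact ⟨h1, fun x hx => h2 x hx.1⟩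
  · have hsS : s ∈ Sg := hs.resolve_right hsQ
    have hAB : Big A := by
      obtain ⟨m', hm'⟩ := hsB
      refine ⟨m' * 2, ?_⟩
      filter_upwards [hm'] with n hn
      rw [mul_assoc]
      refine hn.trans (Nat.mul_le_mul_left _ (le_trans (Finset.card_le_card
        (nb_mono subset_rfl ?_)) (hP n).2.2.2.1))
      exact Finset.subset_biUnion_of_mem (fun i => D i n) hsS
    obtain ⟨l, hl, hlB⟩ := hAB.biUnion (s := Sg) (F := fun i n => A n ∩ D i n)
      (Eventually.of_forall fun n v hv => by
        have := (hP n).2.1 hv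
        simp only [hDS, Finset.mem_biUnion] at this
        obtain ⟨i, hi, hvi⟩ := this
        simp only [Finset.mem_biUnion, Finset.mem_inter]
        exact ⟨i, hi, hv, hvi⟩)
    let D' : ι → c.ISet := fun i n => if i = l then A n ∩ D l n else
      if i ∈ Sg ∨ i ∈ Q then nn (c.G n) (C n) (D i n) else D i n
    refine ⟨l, hl, D', ⟨fun i n => ?_, fun i => ?_⟩, ?_⟩
    · simp only [D']; split_ifs with h1 h2
      · subst h1; exact Finset.inter_subset_right
      · exact nn_sub _ _
      · exact subset_rfl
    · by_cases h1 : i = l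
      · subst h1; exact hlB.mono' fun n => by simp [D']
      · by_cases h2 : i ∈ Sg ∨ i ∈ Q
        · exact (hnn i h2).mono' fun n => by simp only [D', if_neg h1, if_pos h2]; exact subset_rfl
        · exact (hD.big i).mono' fun n => by simp only [D', if_neg h1, if_neg h2]; exact subset_rfl
    · refine Eventually.of_forall fun n v hv => ?_
      simp only [D', if_true, Finset.mem_inter] at hv
      obtain ⟨y, e, he, hec, hvy, hvn⟩ := (hP n).2.2.1 v hv.1
      refine ⟨y, e, he, hvy, hvn, fun x hx => ⟨?_, fun q hq z hz => ?_⟩⟩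
      · have := (hP n).1 (hec hx)
        simp only [hDU, Finset.mem_biUnion] at this
        exact this
      · have hql : q ≠ l := by
          rcases hq with h | h
          · exact h.2
          · rintro rfl; exact hSQ _ hl h
        have hqq : q ∈ Sg ∨ q ∈ Q := hq.imp And.left id
        simp only [D', if_neg hql, if_pos hqq, mem_nn] at hz
        exact hz.2 x (hec hx)
end Ctx
end TN

namespace TN
open Filter Classical
namespace Ctx
variable {c : Ctx} {ι : Type*}
variable {D0 D D' D1 D2 : ι → c.ISet} {δ η a : ℕ} {r : ι} {A A2 Q Q1 Q2 : Set ι}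

lemma Chd.mono (h : Chd D D' δ η r A Q) (hA : A ⊆ A2) (hQ : Q2 ⊆ Q) : Chd D D' δ η r A2 Q2 := by
  filter_upwards [h] with n h v hv
  obtain ⟨y, C, h1, h2, h3, h4⟩ := h v hv
  refine ⟨y, C, h1, h2, h3, fun x hx => ?_⟩
  obtain ⟨⟨i, hi, hxi⟩, h5⟩ := h4 x hx
  exact ⟨⟨i, hA hi, hxi⟩, fun q hq => h5 q (hQ hq)⟩

lemma rounds (hT : Tok D0) (E : (ι → c.ISet) → Prop) (hE : ∀ D D1, Con D D1 → E D1 → E D)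
    (A S : ℕ → Set ι) (hAS : ∀ a < δ, A a ⊆ S a) (hSS : ∀ a < δ, S (a + 1) ⊆ S a)
    (hAA : ∀ a < δ, ∀ b < a, ∀ i ∈ A b, i ∉ A a) (hr : ∀ a < δ, r ∉ A a)
    (hstep : ∀ a < δ, ∀ D, Con D0 D → E D ∨ ∃ D', Con D D' ∧ Chd D D' δ η r (A a) (S (a + 1)))
    (D : ι → c.ISet) (hD : Con D0 D) :
    E D ∨ ∃ D', Con D D' ∧ Rt D D' δ (η + 1) r {i | ∃ a < δ, i ∈ A a} (S δ) := by
  by_cases hED : E D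
  · exact Or.inl hED
  right
  have key : ∀ a ≤ δ, ∃ D', Con D D' ∧ KidsAt D D' δ η r a {i | ∃ b < a, i ∈ A b} (S a) := by
    intro a
    induction a with
    | zero => intro _; exact ⟨D, Con.refl hD.big, KidsAt.zero⟩
    | succ a ih =>
      intro ha
      obtain ⟨D1, hD1, hk⟩ := ih (by omega)
      obtain h | ⟨D2, hD2, hc⟩ := hstep a (by omega) D1 (hD.trans hD1)
      · exact absurd (hE _ _ hD1 h) hED
      · refine ⟨D2, hD1.trans hD2, ?_⟩
        refine (KidsAt.step (hT.con hD) hD1.le hD2.le hk hc (hAS a (by omega)) (hSS a (by omega))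
          ?_ (hr a (by omega))).mono (fun _ _ => subset_rfl) ?_ subset_rfl
        · rintro i ⟨b, hb, hi⟩; exact hAA a (by omega) b hb i hi
        · rintro i (⟨b, hb, hi⟩ | hi)
          · exact ⟨b, by omega, hi⟩
          · exact ⟨a, by omega, hi⟩
  obtain ⟨D', h1, h2⟩ := key δ le_rfl
  exact ⟨D', h1, h2.rt le_rfl⟩

lemma att (hT : Tok D0) (Sg : Finset ι) (hSg : Sg.Nonempty) (M : ℕ) (hM : Sg.card * δ ≤ M)
    (U : ℕ → Set ι) (Qx : Set ι) (hUU : ∀ a b, b < a → ∀ i ∈ U b, i ∉ U a)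
    (hSU : ∀ l ∈ Sg, ∀ m, l ∉ U m)
    (hC : ∀ m < M, ∀ D, Con D0 D → ∃ l ∈ Sg, ∃ D', Con D D' ∧ Chd D D' δ η l (U m)
      {q | (q ∈ Sg ∧ q ≠ l) ∨ (∃ m', m < m' ∧ m' < M ∧ q ∈ U m') ∨ q ∈ Qx})
    (D : ι → c.ISet) (hD : Con D0 D) :
    ∃ D', Con D D' ∧ ∃ l ∈ Sg, Rt D D' δ (η + 1) l {i | ∃ m < M, i ∈ U m}
      {q | (q ∈ Sg ∧ q ≠ l) ∨ q ∈ Qx} := by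
  have key : ∀ k ≤ M, ∃ D', Con D D' ∧ ∃ a : ι → ℕ, ∑ l ∈ Sg, a l = k ∧ ∀ l ∈ Sg,
      KidsAt D D' δ η l (a l) {i | ∃ m < k, i ∈ U m}
        {q | (q ∈ Sg ∧ q ≠ l) ∨ (∃ m', k ≤ m' ∧ m' < M ∧ q ∈ U m') ∨ q ∈ Qx} := by
    intro k
    induction k with
    | zero => intro _; exact ⟨D, Con.refl hD.big, fun _ => 0, by simp, fun l _ => KidsAt.zero⟩
    | succ k ih =>
      intro hk
      obtain ⟨D1, hD1, a, ha, hka⟩ := ih (by omega)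
      obtain ⟨l0, hl0, D2, hD2, hc⟩ := hC k (by omega) D1 (hD.trans hD1)
      refine ⟨D2, hD1.trans hD2, fun l => a l + if l = l0 then 1 else 0, ?_, fun l hl => ?_⟩
      · rw [Finset.sum_add_distrib, ha]; simp [hl0]
      · by_cases e : l = l0
        · subst e
          simp only [if_true]
          refine (KidsAt.step (hT.con hD) hD1.le hD2.le (hka l hl) hc ?_ ?_
            ?_ (hSU l hl k)).mono (fun _ _ => subset_rfl) ?_ ?_
          · intro i hi; exact Or.inr (Or.inl ⟨k, le_rfl, by omega, hi⟩)
          · rintro q (h | ⟨m', h1, h2, h3⟩ | h)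
            · exact Or.inl h
            · exact Or.inr (Or.inl ⟨m', h1.le, h2, h3⟩)
            · exact Or.inr (Or.inr h)
          · rintro i ⟨b, hb, hi⟩; exact hUU k b hb i hi
          · rintro i (⟨b, hb, hi⟩ | hi)
            · exact ⟨b, by omega, hi⟩
            · exact ⟨k, by omega, hi⟩
          · rintro q (h | ⟨m', h1, h2, h3⟩ | h)
            · exact Or.inl h
            · exact Or.inr (Or.inl ⟨m', by omega, h2, h3⟩)
            · exact Or.inr (Or.inr h)
        · simp only [if_neg e, add_zero]
          refine (hka l hl).mono hD2.le ?_ ?_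
          · rintro i ⟨b, hb, hi⟩; exact ⟨b, by omega, hi⟩
          · rintro q (h | ⟨m', h1, h2, h3⟩ | h)
            · exact Or.inl h
            · exact Or.inr (Or.inl ⟨m', by omega, h2, h3⟩)
            · exact Or.inr (Or.inr h)
  obtain ⟨D', hD', a, ha, hka⟩ := key M le_rfl
  have : ∃ l ∈ Sg, δ ≤ a l := by
    by_contra hcon
    push Not at hcon
    have := Finset.sum_lt_sum_of_nonempty hSg hcon
    rw [Finset.sum_const, smul_eq_mul] at this
    omega
  obtain ⟨l, hl, hal⟩ := this
  refine ⟨D', hD', l, hl, ((hka l hl).rt hal).mono (fun _ _ => subset_rfl) subset_rfl ?_⟩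
  rintro q (h | h)
  · exact Or.inl h
  · exact Or.inr (Or.inr h)

end Ctx

/-- interval of tokens -/
def iv (N a b : ℕ) : Finset (Fin N) := Finset.univ.filter (fun i => a ≤ i.1 ∧ i.1 < b)

lemma mem_iv {N a b : ℕ} {i : Fin N} : i ∈ iv N a b ↔ a ≤ i.1 ∧ i.1 < b := by simp [iv]

lemma card_iv {N a b : ℕ} (h : b ≤ N) : (iv N a b).card = b - a := by
  rw [← Nat.card_Ico, ← Finset.card_map (Fin.valEmbedding)]
  congr 1
  ext x
  simp only [Finset.mem_map, mem_iv, Finset.mem_Ico, Fin.valEmbedding_apply]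
  constructor
  · rintro ⟨i, h1, rfl⟩; exact h1
  · intro h1; exact ⟨⟨x, by omega⟩, h1, rfl⟩

namespace Ctx
variable {c : Ctx} {N : ℕ} {D0 : Fin N → c.ISet} {δ : ℕ}

def Ng (δ : ℕ) : ℕ → ℕ
  | 0 => 1
  | η + 1 => δ * Ng δ η + 1

lemma Ng_pos (δ η : ℕ) : 0 < Ng δ η := by cases η <;> simp [Ng]

lemma caseOne (hst : Stable D0)
    (hf : ∀ p q : Fin N, p < q → Abil D0 p q {j | p < j ∧ j ≠ q}) (η : ℕ) :
    ∀ lo, ∀ r : Fin N, r.1 + 1 = lo + Ng δ η → ∀ D, Con D0 D → ∃ D', Con D D' ∧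
      Rt D D' δ η r {i | lo ≤ i.1 ∧ i.1 < r.1} {q | r < q} := by
  induction η with
  | zero => intro lo r hr D hD; exact ⟨D, Con.refl hD.big, Rt.zero⟩
  | succ η ih =>
    intro lo r hr D hD
    set g := Ng δ η with hg
    have hg0 : 0 < g := Ng_pos _ _
    have hr' : r.1 = lo + δ * g := by rw [Ng, ← hg] at hr; omega
    have hmul : ∀ a < δ, (a + 1) * g ≤ δ * g := fun a ha => Nat.mul_le_mul_right _ (by omega)
    have hs : ∀ a : ℕ, (a + 1) * g = a * g + g := fun a => by ring
    obtain h | ⟨D', h1, h2⟩ := rounds (r := r) (η := η) hst.tok (fun _ => False)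
      (fun _ _ _ h => h)
      (fun a => {i : Fin N | lo + a * g ≤ i.1 ∧ i.1 < lo + (a + 1) * g})
      (fun a => {i : Fin N | lo + a * g ≤ i.1 ∧ i ≠ r})
      (by
        intro a ha i hi
        have := hmul a ha
        simp only [Set.mem_ofPred_eq] at hi ⊢
        exact ⟨hi.1, fun e => by subst e; omega⟩)
      (by
        intro a ha i hi
        simp only [Set.mem_ofPred_eq] at hi ⊢
        have := hs a
        exact ⟨by omega, hi.2⟩)
      (by
        intro a ha b hb i hi hi'
        simp only [Set.mem_ofPred_eq] at hi hi'
        have : (b + 1) * g ≤ a * g := Nat.mul_le_mul_right _ hb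
        omega)
      (by
        intro a ha h
        have := hmul a ha
        simp only [Set.mem_ofPred_eq] at h
        omega)
      (by
        intro a ha D hD
        right
        have e1 := hmul a ha
        have e2 := hs a
        let t : Fin N := ⟨lo + (a + 1) * g - 1, by have := r.2; omega⟩
        have ht : t.1 + 1 = lo + (a + 1) * g := by simp only [t]; omega
        obtain ⟨D1, hD1, hrt⟩ := ih (lo + a * g) t (by omega) D hD
        have htr : t < r := by rw [Fin.lt_def]; omega
        obtain ⟨D2, hD2, hc⟩ := push hst hD hD1 hrt (r := r) htr
          (Q := {q | t < q ∧ q ≠ r}) (fun q hq => hq.1) (fun h => h.2 rfl) (hf t r htr)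
        refine ⟨D2, hD1.trans hD2, hc.mono ?_ ?_⟩
        · rintro i (rfl | hi)
          · simp only [Set.mem_ofPred_eq]; omega
          · simp only [Set.mem_ofPred_eq] at hi ⊢; omega
        · rintro q ⟨h1, h2⟩
          simp only [Set.mem_ofPred_eq]
          exact ⟨by rw [Fin.lt_def]; omega, h2⟩) D hD
    · exact h.elim
    · refine ⟨D', h1, h2.mono (fun _ _ => subset_rfl) ?_ ?_⟩
      · rintro i ⟨a, ha, h3, h4⟩
        have := hmul a ha
        exact ⟨by omega, by omega⟩
      · intro q hq
        simp only [Set.mem_ofPred_eq, Fin.lt_def] at hq ⊢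
        exact ⟨by omega, fun e => by subst e; omega⟩

lemma caseTwo (hst : Stable D0)
    (hf : ∀ p q : Fin N, p < q → Abil D0 p q {j | j < p ∨ q < j}) (η : ℕ) :
    ∀ lo, ∀ r : Fin N, r.1 + 1 = lo + Ng δ η → ∀ D, Con D0 D → ∃ D', Con D D' ∧
      Rt D D' δ η r {i | lo ≤ i.1 ∧ i.1 < r.1} {q | q.1 < lo ∨ r < q} := by
  induction η with
  | zero => intro lo r hr D hD; exact ⟨D, Con.refl hD.big, Rt.zero⟩
  | succ η ih =>
    intro lo r hr D hD
    set g := Ng δ η with hg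
    have hg0 : 0 < g := Ng_pos _ _
    have hr' : r.1 = lo + δ * g := by rw [Ng, ← hg] at hr; omega
    have hmul : ∀ a < δ, (a + 1) * g ≤ δ * g := fun a ha => Nat.mul_le_mul_right _ (by omega)
    have hs : ∀ a : ℕ, (a + 1) * g = a * g + g := fun a => by ring
    obtain h | ⟨D', h1, h2⟩ := rounds (r := r) (η := η) hst.tok (fun _ => False)
      (fun _ _ _ h => h)
      (fun a => {i : Fin N | r.1 ≤ i.1 + (a + 1) * g ∧ i.1 + a * g < r.1})
      (fun a => {i : Fin N | i.1 + a * g < r.1 ∨ r < i})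
      (by
        intro a ha i hi
        exact Or.inl hi.2)
      (by
        intro a ha i hi
        simp only [Set.mem_ofPred_eq] at hi ⊢
        have := hs a
        exact hi.imp (fun h => by omega) id)
      (by
        intro a ha b hb i hi hi'
        simp only [Set.mem_ofPred_eq] at hi hi'
        have : (b + 1) * g ≤ a * g := Nat.mul_le_mul_right _ hb
        omega)
      (by
        intro a ha h
        simp only [Set.mem_ofPred_eq] at h
        omega)
      (by
        intro a ha D hD
        right
        have e1 := hmul a ha
        have e2 := hs a
        let t : Fin N := ⟨r.1 - a * g - 1, by have := r.2; omega⟩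
        have ht : t.1 + 1 + a * g = r.1 := by simp only [t]; omega
        obtain ⟨D1, hD1, hrt⟩ := ih (r.1 - (a + 1) * g) t (by omega) D hD
        have htr : t < r := by rw [Fin.lt_def]; omega
        obtain ⟨D2, hD2, hc⟩ := push hst hD hD1 hrt (r := r) (Or.inr htr)
          (Q := {q | q.1 < r.1 - (a + 1) * g ∨ r < q})
          (fun q hq => hq.imp id (fun h => htr.trans h))
          (fun h => by rcases h with h | h
                       · omega
                       · exact lt_irrefl _ h)
          ((hf t r htr).anti (fun q hq => hq.imp (fun h => by rw [Fin.lt_def]; omega) id))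
        refine ⟨D2, hD1.trans hD2, hc.mono ?_ ?_⟩
        · rintro i (rfl | hi)
          · simp only [Set.mem_ofPred_eq]; omega
          · simp only [Set.mem_ofPred_eq] at hi ⊢; omega
        · rintro q hq
          exact hq.imp (fun h => by omega) id) D hD
    · exact h.elim
    · refine ⟨D', h1, h2.mono (fun _ _ => subset_rfl) ?_ ?_⟩
      · rintro i ⟨a, ha, h3, h4⟩
        have := hmul a ha
        exact ⟨by omega, by omega⟩
      · intro q hq
        exact hq.imp (fun h => by omega) id
end Ctx
end TN

namespace TN
open Filter Classical
namespace Ctx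
variable {c : Ctx} {N : ℕ} {D0 : Fin N → c.ISet} {δ : ℕ}

/-- counting form: forward ability fails -/
def NegF (D0 : Fin N → c.ISet) (x y z : ℕ) : Prop :=
  ∀ p q : Fin N, p < q → ∀ (J : Set (Fin N)) (S1 S2 S3 : Finset (Fin N)),
    (∀ j ∈ S1, j ∈ J ∧ j < p) → (∀ j ∈ S2, j ∈ J ∧ p < j ∧ j < q) → (∀ j ∈ S3, j ∈ J ∧ q < j) →
    x ≤ S1.card → y ≤ S2.card → z ≤ S3.card → ¬ Abil D0 p q J

/-- counting form: backward ability fails -/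
def NegB (D0 : Fin N → c.ISet) (x y z : ℕ) : Prop :=
  ∀ p q : Fin N, p < q → ∀ (J : Set (Fin N)) (S1 S2 S3 : Finset (Fin N)),
    (∀ j ∈ S1, j ∈ J ∧ j < p) → (∀ j ∈ S2, j ∈ J ∧ p < j ∧ j < q) → (∀ j ∈ S3, j ∈ J ∧ q < j) →
    x ≤ S1.card → y ≤ S2.card → z ≤ S3.card → ¬ Abil D0 q p J

def NB (δ n : ℕ) : ℕ → ℕ
  | 0 => 0
  | η + 1 => n * δ * (n * n + NB δ n η) + 2 * n

lemma ex_zero (L : Finset (Fin N)) (hL : L.Nonempty) (K : Set (Fin N)) : Ex D0 δ 0 L K := by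
  refine ex_of_rt fun D hD => ⟨D, Con.refl hD.big, hL.choose, hL.choose_spec, Rt.zero⟩

lemma caseB {n : ℕ} (hn : 0 < n) (hst : Stable D0) (g2 : NegF D0 n 0 n) (gQ : NegF D0 0 n 0)
    (η : ℕ) : ∀ (L : Finset (Fin N)) (lo : ℕ), (∀ l ∈ L, l.1 < lo) → n ≤ L.card →
      lo + NB δ n η ≤ N → Ex D0 δ η L (iv N lo (lo + NB δ n η)) := by
  induction η with
  | zero => intro L lo hL hc _; exact ex_zero L (Finset.card_pos.1 (by omega)) _
  | succ η ih =>
    intro L' lo hL' hc' hN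
    obtain ⟨L, hLL, hc⟩ := Finset.exists_subset_card_eq hc'
    have hL : ∀ l ∈ L, l.1 < lo := fun l hl => hL' l (hLL hl)
    refine Ex.mono (L := (L : Set (Fin N))) ?_ (by exact_mod_cast hLL) subset_rfl
    set g := NB δ n η with hg
    obtain ⟨u, hu⟩ : ∃ u, u = n * n + g := ⟨_, rfl⟩
    obtain ⟨M, hM⟩ : ∃ M, M = n * δ := ⟨_, rfl⟩
    have hNB : NB δ n (η + 1) = M * u + 2 * n := by rw [NB, ← hg, hu, hM]
    rw [hNB] at hN ⊢
    have hLne : L.Nonempty := Finset.card_pos.1 (by omega)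
    have hs : ∀ a : ℕ, (a + 1) * u = a * u + u := fun a => by ring
    have hmul : ∀ a < M, (a + 1) * u ≤ M * u := fun a ha => Nat.mul_le_mul_right _ (by omega)
    refine ex_of_rt fun D hD => ?_
    obtain ⟨D', hD', l, hl, hrt⟩ := att (δ := δ) (η := η) hst.tok L hLne M (by rw [hc, hM])
      (fun m => (iv N (lo + m * u) (lo + (m + 1) * u) : Set (Fin N)))
      (iv N (lo + M * u) (lo + M * u + 2 * n) : Set (Fin N))
      (by
        intro a b hab i hi hi'
        simp only [Finset.mem_coe, mem_iv] at hi hi'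
        have : (b + 1) * u ≤ a * u := Nat.mul_le_mul_right _ hab
        omega)
      (by
        intro l hl m h
        simp only [Finset.mem_coe, mem_iv] at h
        have := hL l hl
        omega)
      (by
        intro m hm D hD
        have e1 := hs m
        have e2 := hmul m hm
        have hb : ∀ b : Fin n, (b.1 + 1) * n ≤ n * n := fun b => Nat.mul_le_mul_right _ b.2
        have hb' : ∀ b : ℕ, (b + 1) * n = b * n + n := fun b => by ring
        obtain ⟨l, hl, D', hD', hch⟩ := composite (δ := δ) (η := η) hst L
          (iv N (lo + m * u) (lo + (m + 1) * u))
          (iv N (lo + (m + 1) * u) (lo + M * u + 2 * n)) hLne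
          (fun i hi h => by rw [mem_iv] at h; have := hL i hi; omega)
          (fun i hi h => by rw [mem_iv] at h; have := hL i hi; omega)
          (by
            intro i hi q hq
            rw [mem_iv] at hi hq
            by_cases hq2 : q.1 + 1 + n ≤ lo + M * u + 2 * n
            · refine g2 i q (by rw [Fin.lt_def]; omega) _ L ∅ (iv N (q.1 + 1) (q.1 + 1 + n))
                ?_ (by simp) ?_ hc.ge (by simp) (by rw [card_iv (by omega)]; omega)
              · intro j hj
                have := hL j hj
                refine ⟨⟨Or.inl hj, fun e => by subst e; omega⟩, by rw [Fin.lt_def]; omega⟩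
              · intro j hj
                rw [mem_iv] at hj
                refine ⟨⟨Or.inr (mem_iv.2 (by omega)), fun e => by subst e; omega⟩,
                  by rw [Fin.lt_def]; omega⟩
            · refine gQ i q (by rw [Fin.lt_def]; omega) _ ∅
                (iv N (lo + (m + 1) * u) (lo + (m + 1) * u + n)) ∅ (by simp) ?_ (by simp)
                (by simp) (by rw [card_iv (by omega)]; omega) (by simp)
              intro j hj
              rw [mem_iv] at hj
              exact ⟨⟨Or.inr (mem_iv.2 (by omega)), fun e => by subst e; omega⟩,
                by rw [Fin.lt_def]; omega, by rw [Fin.lt_def]; omega⟩)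
          (h := n)
          (fun b => iv N (lo + m * u + b.1 * n) (lo + m * u + (b.1 + 1) * n))
          (iv N (lo + m * u + n * n) (lo + m * u + u))
          (by
            intro b
            have := hb b
            have := hb' b.1
            exact ⟨⟨lo + m * u + b.1 * n, by omega⟩, mem_iv.2 (by simp only []; omega)⟩)
          (by
            intro b j hj
            have := hb b
            have := hb' b.1
            rw [mem_iv] at hj ⊢
            omega)
          (by
            intro j hj
            rw [mem_iv] at hj ⊢
            omega)
          (by
            intro b j hj h
            have := hb b
            rw [mem_iv] at hj h
            omega)
          (by
            intro b l hl k hk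
            have := hb b
            have := hb' b.1
            have := hL l hl
            rw [mem_iv] at hk
            refine gQ l k (by rw [Fin.lt_def]; omega) _ ∅ _ ∅ (by simp) (fun j hj => ⟨hj, ?_⟩)
              (by simp) (by simp) (by rw [card_iv (by omega)]; omega) (by simp)
            rw [mem_iv] at hj
            exact ⟨by rw [Fin.lt_def]; omega, by rw [Fin.lt_def]; omega⟩)
          (by
            intro j hj
            have hinj : Function.Injective j := by
              intro b b' e
              have h1 := mem_iv.1 (hj b)
              have h2 := mem_iv.1 (hj b')
              rw [← e] at h2
              by_contra hne
              rcases lt_or_gt_of_ne hne with h | h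
              · have : (b.1 + 1) * n ≤ b'.1 * n := Nat.mul_le_mul_right _ h
                omega
              · have : (b'.1 + 1) * n ≤ b.1 * n := Nat.mul_le_mul_right _ h
                omega
            have := ih (Finset.univ.image j) (lo + m * u + n * n) (by
                intro l hl
                obtain ⟨b, -, rfl⟩ := Finset.mem_image.1 hl
                have h1 := mem_iv.1 (hj b)
                have := hb b
                omega) (by rw [Finset.card_image_of_injective _ hinj]; simp) (by omega)
            refine this.mono (by simp) ?_
            intro k hk
            simp only [Finset.mem_coe, mem_iv] at hk ⊢
            omega)
          D hD
        refine ⟨l, hl, D', hD', hch.mono subset_rfl ?_⟩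
        rintro q (h | ⟨m', h1, h2, h3⟩ | h)
        · exact Or.inl h
        · simp only [Finset.mem_coe, mem_iv] at h3
          have := hmul m' h2
          have : (m + 1) * u ≤ m' * u := Nat.mul_le_mul_right _ h1
          exact Or.inr (mem_iv.2 (by omega))
        · simp only [Finset.mem_coe, mem_iv] at h
          exact Or.inr (mem_iv.2 (by omega))) D hD
    refine ⟨D', hD', l, hl, hrt.mono (fun _ _ => subset_rfl) ?_ (by simp)⟩
    rintro i ⟨m, hm, hi⟩
    have := hmul m hm
    simp only [Finset.mem_coe, mem_iv] at hi ⊢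
    omega
end Ctx
end TN

namespace TN
open Filter Classical
namespace Ctx
variable {c : Ctx} {N : ℕ} {D0 : Fin N → c.ISet} {δ : ℕ}

lemma attLR {n η : ℕ} (hn : 0 < n) (hst : Stable D0) (g1 : NegF D0 0 n n) (g2 : NegF D0 n 0 n)
    (g4 : NegB D0 n n 0) (g : ℕ)
    (hleft : ∀ (L : Finset (Fin N)) (lo : ℕ), (∀ l ∈ L, l.1 < lo) → n ≤ L.card →
      lo + g ≤ N → Ex D0 δ η L (iv N lo (lo + g)))
    (hright : ∀ (R : Finset (Fin N)) (lo : ℕ), (∀ l ∈ R, lo + g ≤ l.1) → n ≤ R.card →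
      lo + g ≤ N → Ex D0 δ η R (iv N lo (lo + g)))
    (L R : Finset (Fin N)) (hLc : L.card = n) (hRc : R.card = n) (lo hi M u : ℕ)
    (hL : ∀ l ∈ L, l.1 < lo) (hR : ∀ l ∈ R, hi ≤ l.1) (hM : M = 2 * n * δ)
    (hu : u = 2 * n * n + g + 2 * n * n) (hlh : lo + M * u ≤ hi) (hiN : hi ≤ N)
    (D : Fin N → c.ISet) (hD : Con D0 D) :
    ∃ D', Con D D' ∧ ∃ l, (l ∈ L ∨ l ∈ R) ∧ Rt D D' δ (η + 1) l (iv N lo (lo + M * u))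
      {q | ((q ∈ L ∨ q ∈ R) ∧ q ≠ l) ∨ (lo + M * u ≤ q.1 ∧ q.1 < hi)} := by
  have hLne : L.Nonempty := Finset.card_pos.1 (by omega)
  have hs : ∀ a : ℕ, (a + 1) * u = a * u + u := fun a => by ring
  have hmul : ∀ a < M, (a + 1) * u ≤ M * u := fun a ha => Nat.mul_le_mul_right _ (by omega)
  have hLR : ∀ l ∈ L ∪ R, l.1 < lo ∨ hi ≤ l.1 := by
    intro l hl
    rcases Finset.mem_union.1 hl with h | h
    · exact Or.inl (hL l h)
    · exact Or.inr (hR l h)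
  obtain ⟨D', hD', l, hl, hrt⟩ := att (δ := δ) (η := η) hst.tok (L ∪ R) (hLne.inl) M
      (by
        rw [hM]
        refine Nat.mul_le_mul_right _ ((Finset.card_union_le _ _).trans ?_)
        omega)
      (fun m => if m < M then (iv N (lo + m * u) (lo + (m + 1) * u) : Set (Fin N)) else ∅)
      (iv N (lo + M * u) hi : Set (Fin N))
      (by
        intro a b hab i hi hi'
        by_cases ha : a < M
        · simp only [if_pos ha, if_pos (hab.trans ha), Finset.mem_coe, mem_iv] at hi hi'
          have : (b + 1) * u ≤ a * u := Nat.mul_le_mul_right _ hab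
          omega
        · simp [ha] at hi')
      (by
        intro l hl m h
        by_cases ha : m < M
        · simp only [if_pos ha, Finset.mem_coe, mem_iv] at h
          have := hLR l hl
          have := hmul m ha
          omega
        · simp [ha] at h)
      (by
        intro m hm D hD
        have e1 := hs m
        have e2 := hmul m hm
        obtain ⟨P, hP⟩ : ∃ P, P = 2 * n * n + g := ⟨_, rfl⟩
        have hb : ∀ b : Fin (2 * n), (b.1 + 1) * n ≤ 2 * n * n :=
          fun b => Nat.mul_le_mul_right _ b.2
        have hb' : ∀ b : ℕ, (b + 1) * n = b * n + n := fun b => by ring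
        generalize 2 * n * n = w at *
        obtain ⟨l, hl, D', hD', hch⟩ := composite (δ := δ) (η := η) hst (L ∪ R)
          (iv N (lo + m * u) (lo + (m + 1) * u))
          (iv N (lo + (m + 1) * u) hi) hLne.inl
          (fun i hi h => by rw [mem_iv] at h; have := hLR i hi; omega)
          (fun i hi h => by rw [mem_iv] at h; have := hLR i hi; omega)
          (by
            intro i hi q hq
            rw [mem_iv] at hi hq
            refine g2 i q (by rw [Fin.lt_def]; omega) _ L ∅ R
                ?_ (by simp) ?_ hLc.ge (by simp) hRc.ge
            · intro j hj
              have := hL j hj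
              refine ⟨⟨Or.inl (Finset.mem_union_left _ hj), fun e => by subst e; omega⟩,
                by rw [Fin.lt_def]; omega⟩
            · intro j hj
              have := hR j hj
              refine ⟨⟨Or.inl (Finset.mem_union_right _ hj), fun e => by subst e; omega⟩,
                by rw [Fin.lt_def]; omega⟩)
          (h := 2 * n)
          (fun b => iv N (lo + m * u + b.1 * n) (lo + m * u + (b.1 + 1) * n) ∪
            iv N (lo + m * u + P + b.1 * n) (lo + m * u + P + (b.1 + 1) * n))
          (iv N (lo + m * u + w) (lo + m * u + P))
          (by
            intro b
            have := hb b
            have := hb' b.1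
            exact ⟨⟨lo + m * u + b.1 * n, by omega⟩,
              Finset.mem_union_left _ (mem_iv.2 (by simp only []; omega))⟩)
          (by
            intro b j hj
            have := hb b
            have := hb' b.1
            rw [Finset.mem_union, mem_iv, mem_iv] at hj
            rw [mem_iv]
            omega)
          (by
            intro j hj
            rw [mem_iv] at hj ⊢
            omega)
          (by
            intro b j hj h
            have := hb b
            rw [Finset.mem_union, mem_iv, mem_iv] at hj
            rw [mem_iv] at h
            omega)
          (by
            intro b l hl k hk
            have := hb b
            have := hb' b.1
            rw [mem_iv] at hk
            rcases Finset.mem_union.1 hl with hl | hl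
            · have := hL l hl
              refine g1 l k (by rw [Fin.lt_def]; omega) _ ∅
                (iv N (lo + m * u + b.1 * n) (lo + m * u + (b.1 + 1) * n))
                (iv N (lo + m * u + P + b.1 * n) (lo + m * u + P + (b.1 + 1) * n)) (by simp)
                (fun j hj => ⟨Finset.mem_union_left _ hj, ?_⟩)
                (fun j hj => ⟨Finset.mem_union_right _ hj, ?_⟩) (by simp)
                (by rw [card_iv (by omega)]; omega) (by rw [card_iv (by omega)]; omega)
              · rw [mem_iv] at hj
                exact ⟨by rw [Fin.lt_def]; omega, by rw [Fin.lt_def]; omega⟩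
              · rw [mem_iv] at hj
                rw [Fin.lt_def]; omega
            · have := hR l hl
              refine g4 k l (by rw [Fin.lt_def]; omega) _
                (iv N (lo + m * u + b.1 * n) (lo + m * u + (b.1 + 1) * n))
                (iv N (lo + m * u + P + b.1 * n) (lo + m * u + P + (b.1 + 1) * n)) ∅
                (fun j hj => ⟨Finset.mem_union_left _ hj, ?_⟩)
                (fun j hj => ⟨Finset.mem_union_right _ hj, ?_⟩) (by simp)
                (by rw [card_iv (by omega)]; omega) (by rw [card_iv (by omega)]; omega) (by simp)
              · rw [mem_iv] at hj
                rw [Fin.lt_def]; omega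
              · rw [mem_iv] at hj
                exact ⟨by rw [Fin.lt_def]; omega, by rw [Fin.lt_def]; omega⟩)
          (by
            intro j hj
            simp only [Finset.mem_union, mem_iv] at hj
            have hinj : Function.Injective j := by
              intro b b' e
              have h1 := hj b
              have h2 := hj b'
              have := hb b
              have := hb b'
              rw [← e] at h2
              by_contra hne
              rcases lt_or_gt_of_ne hne with h | h
              · have : (b.1 + 1) * n ≤ b'.1 * n := Nat.mul_le_mul_right _ h
                omega
              · have : (b'.1 + 1) * n ≤ b.1 * n := Nat.mul_le_mul_right _ h
                omega
            have hcs : (Finset.univ.filter fun b => (j b).1 < lo + m * u + w).card +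
                (Finset.univ.filter fun b => ¬ (j b).1 < lo + m * u + w).card = 2 * n := by
              rw [Finset.card_filter_add_card_filter_not]; simp
            have hK : iv N (lo + m * u + w) (lo + m * u + w + g) =
              iv N (lo + m * u + w) (lo + m * u + P) := by rw [hP, ← add_assoc]
            have hcase : n ≤ (Finset.univ.filter fun b => (j b).1 < lo + m * u + w).card ∨
              n ≤ (Finset.univ.filter fun b => ¬ (j b).1 < lo + m * u + w).card := by omega
            rcases hcase with hcase | hcase
            · have := hleft ((Finset.univ.filter fun b => (j b).1 < lo + m * u + w).image j)
                (lo + m * u + w) (by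
                  intro l hl
                  obtain ⟨b, hb, rfl⟩ := Finset.mem_image.1 hl
                  exact (Finset.mem_filter.1 hb).2)
                (by rw [Finset.card_image_of_injective _ hinj]; exact hcase) (by omega)
              rw [hK] at this
              refine this.mono ?_ subset_rfl
              intro x hx
              obtain ⟨b, hb, rfl⟩ := Finset.mem_image.1 hx
              exact ⟨b, rfl⟩
            · have := hright ((Finset.univ.filter fun b => ¬ (j b).1 < lo + m * u + w).image j)
                (lo + m * u + w) (by
                  intro l hl
                  obtain ⟨b, hb', rfl⟩ := Finset.mem_image.1 hl
                  have h3 := (Finset.mem_filter.1 hb').2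
                  have h1 := hj b
                  have := hb b
                  omega)
                (by rw [Finset.card_image_of_injective _ hinj]; exact hcase) (by omega)
              rw [hK] at this
              refine this.mono ?_ subset_rfl
              intro x hx
              obtain ⟨b, hb, rfl⟩ := Finset.mem_image.1 hx
              exact ⟨b, rfl⟩)
          D hD
        refine ⟨l, hl, D', hD', hch.mono (by simp [hm]) ?_⟩
        rintro q (h | ⟨m', h1, h2, h3⟩ | h)
        · exact Or.inl h
        · simp only [if_pos h2, Finset.mem_coe, mem_iv] at h3
          have := hmul m' h2
          have : (m + 1) * u ≤ m' * u := Nat.mul_le_mul_right _ h1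
          exact Or.inr (mem_iv.2 (by omega))
        · simp only [Finset.mem_coe, mem_iv] at h
          exact Or.inr (mem_iv.2 (by omega))) D hD
  refine ⟨D', hD', l, Finset.mem_union.1 hl, hrt.mono (fun _ _ => subset_rfl) ?_ ?_⟩
  · rintro i ⟨m, hm, hi⟩
    have := hmul m hm
    simp only [if_pos hm, Finset.mem_coe, mem_iv] at hi ⊢
    omega
  · rintro q (h | h)
    · exact Or.inl ⟨Finset.mem_union.2 h.1, h.2⟩
    · exact Or.inr (mem_iv.2 h)

def NA (δ n : ℕ) : ℕ → ℕ
  | 0 => 0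
  | η + 1 => δ * ((2 * n * δ) * (2 * n * n + NA δ n η + 2 * n * n) + n)

lemma caseA {n : ℕ} (hn : 0 < n) (hst : Stable D0) (g1 : NegF D0 0 n n) (g2 : NegF D0 n 0 n)
    (g4 : NegB D0 n n 0)
    (pQ : ∀ p q : Fin N, p < q → Abil D0 p q {j | p < j ∧ j < q})
    (pQ' : ∀ p q : Fin N, p < q → Abil D0 q p {j | p < j ∧ j < q}) (η : ℕ) :
    (∀ (L : Finset (Fin N)) (lo : ℕ), (∀ l ∈ L, l.1 < lo) → n ≤ L.card →
      lo + NA δ n η ≤ N → Ex D0 δ η L (iv N lo (lo + NA δ n η))) ∧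
    (∀ (R : Finset (Fin N)) (lo : ℕ), (∀ l ∈ R, lo + NA δ n η ≤ l.1) → n ≤ R.card →
      lo + NA δ n η ≤ N → Ex D0 δ η R (iv N lo (lo + NA δ n η))) := by
  induction η with
  | zero => exact ⟨fun L lo hL hc _ => ex_zero L (Finset.card_pos.1 (by omega)) _,
      fun L lo hL hc _ => ex_zero L (Finset.card_pos.1 (by omega)) _⟩
  | succ η ih =>
    obtain ⟨u, hu⟩ : ∃ u, u = 2 * n * n + NA δ n η + 2 * n * n := ⟨_, rfl⟩
    obtain ⟨M, hM⟩ : ∃ M, M = 2 * n * δ := ⟨_, rfl⟩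
    have hattLR := fun L R hLc hRc lo hi hL hR hlh hiN D hD =>
      attLR hn hst g1 g2 g4 (NA δ n η) ih.1 ih.2 L R hLc hRc lo hi M u hL hR hM hu hlh hiN D hD
    have hNA : NA δ n (η + 1) = δ * (M * u + n) := by rw [NA, hu, hM]
    rw [hNA]
    clear hNA ih hM hu
    generalize M * u = w at *
    clear M u
    have hmul : ∀ k, ∀ a < δ, (a + 1) * k ≤ δ * k := fun k a ha => Nat.mul_le_mul_right _ ha
    have hs : ∀ k a : ℕ, (a + 1) * k = a * k + k := fun k a => by ring
    constructor
    · intro L' lo hL' hc' hN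
      obtain ⟨L, hLL, hc⟩ := Finset.exists_subset_card_eq hc'
      have hL : ∀ l ∈ L, l.1 < lo := fun l hl => hL' l (hLL hl)
      refine Ex.mono (L := (L : Set (Fin N))) ?_ (by exact_mod_cast hLL) subset_rfl
      obtain ⟨x, hx⟩ : L.Nonempty := Finset.card_pos.1 (by omega)
      have hxlo := hL x hx
      rw [mul_add, ← add_assoc] at hN ⊢
      obtain ⟨E, hE⟩ : ∃ E, E = lo + δ * w + δ * n := ⟨_, rfl⟩
      rw [← hE] at hN ⊢
      refine ex_of_rt fun D hD => ?_
      have := rounds (δ := δ) (η := η + 1) (r := x) hst.tok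
        (fun D => ∃ D', Con D D' ∧ ∃ r ∈ (L : Set (Fin N)),
          Rt D D' δ (η + 1) r (iv N lo E) ∅)
        (by
          rintro D D1 hD1 ⟨D2, hD2, r, hr, h⟩
          exact ⟨D2, hD1.trans hD2, r, hr, h.base hD1.le⟩)
        (fun b => {i | (lo + b * w ≤ i.1 ∧ i.1 < lo + (b + 1) * w) ∨
          (E - (b + 1) * n ≤ i.1 ∧ i.1 < E - b * n)})
        (fun b => {i | lo + b * w ≤ i.1 ∧ i.1 < E - b * n})
        (by
          intro a ha i hi
          have h1 := hmul w a ha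
          have h2 := hmul n a ha
          have h3 := hs w a
          have h4 := hs n a
          simp only [Set.mem_ofPred_eq] at hi ⊢
          omega)
        (by
          intro a ha i hi
          have h3 := hs w a
          have h4 := hs n a
          simp only [Set.mem_ofPred_eq] at hi ⊢
          omega)
        (by
          intro a ha b hb i hi hi'
          have h1 := hmul w a ha
          have h2 := hmul n a ha
          have h3 := hs w a
          have h4 := hs n a
          have h5 : (b + 1) * w ≤ a * w := Nat.mul_le_mul_right _ hb
          have h6 : (b + 1) * n ≤ a * n := Nat.mul_le_mul_right _ hb
          simp only [Set.mem_ofPred_eq] at hi hi'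
          omega)
        (by
          intro a ha h
          have h1 := hmul w a ha
          have h2 := hmul n a ha
          simp only [Set.mem_ofPred_eq] at h
          omega)
        (by
          intro a ha D hD
          have h1 := hmul w a ha
          have h2 := hmul n a ha
          have h3 := hs w a
          have h4 := hs n a
          obtain ⟨D1, hD1, l, hl, hrt⟩ := hattLR L (iv N (E - (a + 1) * n) (E - a * n)) hc
            (by rw [card_iv (by omega)]; omega) (lo + a * w) (E - (a + 1) * n)
            (fun l hl => by have := hL l hl; omega) (fun l hl => by rw [mem_iv] at hl; omega)
            (by omega) (by omega) D hD
          rcases hl with hl | hl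
          · left
            refine ⟨D1, hD1, l, hl, hrt.mono (fun _ _ => subset_rfl) ?_ (by simp)⟩
            intro i hi
            simp only [Finset.mem_coe, mem_iv] at hi ⊢
            omega
          · right
            rw [mem_iv] at hl
            have hxl : x < l := by rw [Fin.lt_def]; omega
            obtain ⟨D2, hD2, hch⟩ := push hst hD hD1 hrt (r := x)
              (Or.inl ⟨Or.inl hx, hxl.ne⟩)
              (Q := {i | lo + (a + 1) * w ≤ i.1 ∧ i.1 < E - (a + 1) * n})
              (fun q hq => by
                simp only [Set.mem_ofPred_eq] at hq
                exact Or.inr ⟨by omega, by omega⟩)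
              (fun h => by
                simp only [Set.mem_ofPred_eq] at h
                omega)
              ((pQ' x l hxl).anti (fun q hq => by
                simp only [Set.mem_ofPred_eq] at hq
                exact ⟨by rw [Fin.lt_def]; omega, by rw [Fin.lt_def]; omega⟩))
            refine ⟨D2, hD1.trans hD2, hch.mono ?_ subset_rfl⟩
            rintro i (rfl | hi)
            · exact Or.inr hl
            · simp only [Finset.mem_coe, mem_iv] at hi
              exact Or.inl (by omega)) D hD
      rcases this with h | ⟨D', hD', hrt⟩
      · exact h
      · refine ⟨D', hD', x, hx, hrt.trunc.mono (fun _ _ => subset_rfl) ?_ (by simp)⟩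
        rintro i ⟨a, ha, hi⟩
        have h1 := hmul w a ha
        have h2 := hmul n a ha
        have h3 := hs w a
        have h4 := hs n a
        simp only [Set.mem_ofPred_eq] at hi
        simp only [Finset.mem_coe, mem_iv]
        omega
    · intro R' lo hR' hc' hN
      obtain ⟨R, hRR, hc⟩ := Finset.exists_subset_card_eq hc'
      have hR : ∀ l ∈ R, lo + δ * (w + n) ≤ l.1 := fun l hl => hR' l (hRR hl)
      refine Ex.mono (L := (R : Set (Fin N))) ?_ (by exact_mod_cast hRR) subset_rfl
      obtain ⟨x, hx⟩ : R.Nonempty := Finset.card_pos.1 (by omega)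
      obtain ⟨s, hs0⟩ : ∃ s, s = w + n := ⟨_, rfl⟩
      rw [← hs0] at hR hN ⊢
      have hxlo := hR x hx
      obtain ⟨E, hE⟩ : ∃ E, E = lo + δ * s := ⟨_, rfl⟩
      rw [← hE] at hN hxlo ⊢
      refine ex_of_rt fun D hD => ?_
      have := rounds (δ := δ) (η := η + 1) (r := x) hst.tok
        (fun D => ∃ D', Con D D' ∧ ∃ r ∈ (R : Set (Fin N)),
          Rt D D' δ (η + 1) r (iv N lo E) ∅)
        (by
          rintro D D1 hD1 ⟨D2, hD2, r, hr, h⟩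
          exact ⟨D2, hD1.trans hD2, r, hr, h.base hD1.le⟩)
        (fun b => {i | lo + b * s ≤ i.1 ∧ i.1 < lo + (b + 1) * s})
        (fun b => {i | lo + b * s ≤ i.1 ∧ i.1 < E})
        (by
          intro a ha i hi
          have h1 := hmul s a ha
          simp only [Set.mem_ofPred_eq] at hi ⊢
          omega)
        (by
          intro a ha i hi
          have h3 := hs s a
          simp only [Set.mem_ofPred_eq] at hi ⊢
          omega)
        (by
          intro a ha b hb i hi hi'
          have h5 : (b + 1) * s ≤ a * s := Nat.mul_le_mul_right _ hb
          simp only [Set.mem_ofPred_eq] at hi hi'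
          omega)
        (by
          intro a ha h
          have h1 := hmul s a ha
          simp only [Set.mem_ofPred_eq] at h
          omega)
        (by
          intro a ha D hD
          have h1 := hmul s a ha
          have h3 := hs s a
          obtain ⟨D1, hD1, l, hl, hrt⟩ := hattLR (iv N (lo + a * s) (lo + a * s + n)) R
            (by rw [card_iv (by omega)]; omega) hc (lo + a * s + n) E
            (fun l hl => by rw [mem_iv] at hl; omega)
            (fun l hl => by have := hR l hl; omega)
            (by omega) (by omega) D hD
          rcases hl with hl | hl
          · right
            rw [mem_iv] at hl
            have hxl : l < x := by rw [Fin.lt_def]; omega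
            obtain ⟨D2, hD2, hch⟩ := push hst hD hD1 hrt (r := x)
              (Or.inl ⟨Or.inr hx, hxl.ne'⟩)
              (Q := {i | lo + (a + 1) * s ≤ i.1 ∧ i.1 < E})
              (fun q hq => by
                simp only [Set.mem_ofPred_eq] at hq
                exact Or.inr ⟨by omega, by omega⟩)
              (fun h => by
                simp only [Set.mem_ofPred_eq] at h
                omega)
              ((pQ l x hxl).anti (fun q hq => by
                simp only [Set.mem_ofPred_eq] at hq
                exact ⟨by rw [Fin.lt_def]; omega, by rw [Fin.lt_def]; omega⟩))
            refine ⟨D2, hD1.trans hD2, hch.mono ?_ subset_rfl⟩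
            rintro i (rfl | hi)
            · simp only [Set.mem_ofPred_eq]
              omega
            · simp only [Finset.mem_coe, mem_iv] at hi
              simp only [Set.mem_ofPred_eq]
              omega
          · left
            refine ⟨D1, hD1, l, hl, hrt.mono (fun _ _ => subset_rfl) ?_ (by simp)⟩
            intro i hi
            simp only [Finset.mem_coe, mem_iv] at hi ⊢
            omega) D hD
      rcases this with h | ⟨D', hD', hrt⟩
      · exact h
      · refine ⟨D', hD', x, hx, hrt.trunc.mono (fun _ _ => subset_rfl) ?_ (by simp)⟩
        rintro i ⟨a, ha, hi⟩
        have h1 := hmul s a ha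
        simp only [Set.mem_ofPred_eq] at hi
        simp only [Finset.mem_coe, mem_iv]
        omega
end Ctx
end TN

namespace TN
open Filter Classical

lemma ramsey (m : ℕ) : ∀ p q : ℕ, ∃ N : ℕ, ∀ (α : Type) (P : Finset α → Prop) (A : Finset α),
    N ≤ A.card → (∃ S ⊆ A, S.card = p ∧ ∀ X ⊆ S, X.card = m → P X) ∨
      (∃ S ⊆ A, S.card = q ∧ ∀ X ⊆ S, X.card = m → ¬ P X) := by
  induction m with
  | zero =>
    intro p q
    refine ⟨max p q, fun α P A hA => ?_⟩
    by_cases hP : P ∅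
    · obtain ⟨S, hS, hc⟩ := Finset.exists_subset_card_eq ((le_max_left p q).trans hA)
      exact Or.inl ⟨S, hS, hc, fun X _ hX => by rw [Finset.card_eq_zero.1 hX]; exact hP⟩
    · obtain ⟨S, hS, hc⟩ := Finset.exists_subset_card_eq ((le_max_right p q).trans hA)
      exact Or.inr ⟨S, hS, hc, fun X _ hX => by rw [Finset.card_eq_zero.1 hX]; exact hP⟩
  | succ m ihm =>
    have ext : ∀ (α : Type) (P : Finset α → Prop) (a : α) (S S1 : Finset α), a ∉ S → S1 ⊆ S →
        (∀ X ⊆ S, X.card = m → P (insert a X)) → (∀ X ⊆ S1, X.card = m + 1 → P X) →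
        ∀ X ⊆ insert a S1, X.card = m + 1 → P X := by
      intro α P a S S1 ha hS h1 h2 X hX hc
      by_cases haX : a ∈ X
      · have := h1 (X.erase a) (fun x hx => by
          obtain ⟨h3, h4⟩ := Finset.mem_erase.1 hx
          rcases Finset.mem_insert.1 (hX h4) with h | h
          · exact absurd h h3
          · exact hS h) (by rw [Finset.card_erase_of_mem haX, hc]; rfl)
        rwa [Finset.insert_erase haX] at this
      · refine h2 X (fun x hx => ?_) hc
        rcases Finset.mem_insert.1 (hX hx) with h | h
        · exact absurd (h ▸ hx) haX
        · exact h
    intro p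
    induction p with
    | zero =>
      intro q
      exact ⟨0, fun α P A _ => Or.inl ⟨∅, by simp, by simp, fun X hX hc => by
        rw [Finset.subset_empty.1 hX] at hc; simp at hc⟩⟩
    | succ p ihp =>
      intro q
      induction q with
      | zero =>
        exact ⟨0, fun α P A _ => Or.inr ⟨∅, by simp, by simp, fun X hX hc => by
          rw [Finset.subset_empty.1 hX] at hc; simp at hc⟩⟩
      | succ q ihq =>
        obtain ⟨N1, h1⟩ := ihp (q + 1)
        obtain ⟨N2, h2⟩ := ihq
        obtain ⟨N, hN⟩ := ihm N1 N2
        refine ⟨N + 1, fun α P A hA => ?_⟩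
        obtain ⟨a, ha⟩ : A.Nonempty := Finset.card_pos.1 (by omega)
        have hsub : ∀ S ⊆ A.erase a, S ⊆ A := fun S hS => hS.trans (Finset.erase_subset _ _)
        have hna : ∀ S ⊆ A.erase a, a ∉ S := fun S hS h => by simpa using hS h
        rcases hN α (fun X => P (insert a X)) (A.erase a)
          (by rw [Finset.card_erase_of_mem ha]; omega) with ⟨S, hS, hc, hP⟩ | ⟨S, hS, hc, hP⟩
        · rcases h1 α P S hc.ge with ⟨S1, hS1, hc1, hP1⟩ | ⟨S1, hS1, hc1, hP1⟩
          · left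
            refine ⟨insert a S1, Finset.insert_subset ha (hsub _ (hS1.trans hS)), ?_,
              ext α P a S S1 (hna S hS) hS1 hP hP1⟩
            rw [Finset.card_insert_of_notMem (hna _ (hS1.trans hS)), hc1]
          · exact Or.inr ⟨S1, hsub _ (hS1.trans hS), hc1, hP1⟩
        · rcases h2 α P S hc.ge with ⟨S1, hS1, hc1, hP1⟩ | ⟨S1, hS1, hc1, hP1⟩
          · exact Or.inl ⟨S1, hsub _ (hS1.trans hS), hc1, hP1⟩
          · right
            refine ⟨insert a S1, Finset.insert_subset ha (hsub _ (hS1.trans hS)), ?_,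
              ext α (fun X => ¬ P X) a S S1 (hna S hS) hS1 hP hP1⟩
            rw [Finset.card_insert_of_notMem (hna _ (hS1.trans hS)), hc1]

structure Cfg {N : ℕ} (x y z : ℕ) (p q : Fin N) (S1 S2 S3 : Finset (Fin N)) : Prop where
  lt : p < q
  h1 : ∀ j ∈ S1, j < p
  h2 : ∀ j ∈ S2, p < j ∧ j < q
  h3 : ∀ j ∈ S3, q < j
  c1 : S1.card = x
  c2 : S2.card = y
  c3 : S3.card = z

namespace Cfg
variable {N x y z : ℕ} {p q p' q' : Fin N} {S1 S2 S3 S1' S2' S3' : Finset (Fin N)}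

lemma notq (h : Cfg x y z p q S1 S2 S3) : q ∉ S1 ∪ S2 ∪ S3 := by
  simp only [Finset.mem_union]
  rintro ((h' | h') | h')
  · exact absurd (h.h1 _ h') h.lt.not_gt
  · exact absurd (h.h2 _ h').2 (lt_irrefl _)
  · exact absurd (h.h3 _ h') (lt_irrefl _)

lemma notp (h : Cfg x y z p q S1 S2 S3) : p ∉ insert q (S1 ∪ S2 ∪ S3) := by
  simp only [Finset.mem_insert, Finset.mem_union]
  rintro (h' | (h' | h') | h')
  · exact h.lt.ne h'
  · exact absurd (h.h1 _ h') (lt_irrefl _)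
  · exact absurd (h.h2 _ h').1 (lt_irrefl _)
  · exact absurd (h.h3 _ h') h.lt.not_gt

lemma card (h : Cfg x y z p q S1 S2 S3) :
    (insert p (insert q (S1 ∪ S2 ∪ S3))).card = x + y + z + 2 := by
  rw [Finset.card_insert_of_notMem h.notp, Finset.card_insert_of_notMem h.notq,
    Finset.card_union_of_disjoint, Finset.card_union_of_disjoint, h.c1, h.c2, h.c3]
  · rw [Finset.disjoint_left]
    intro j h1 h2
    exact absurd (h.h1 j h1) (h.h2 j h2).1.not_gt
  · rw [Finset.disjoint_left]
    intro j h1 h2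
    have h3 := h.h3 j h2
    rcases Finset.mem_union.1 h1 with h1 | h1
    · exact absurd ((h.h1 j h1).trans h.lt) h3.not_gt
    · exact absurd (h.h2 j h1).2 h3.not_gt

lemma filter_lt (h : Cfg x y z p q S1 S2 S3) :
    ((insert p (insert q (S1 ∪ S2 ∪ S3))).filter (· < p)) = S1 := by
  ext j
  simp only [Finset.mem_filter, Finset.mem_insert, Finset.mem_union]
  constructor
  · rintro ⟨rfl | rfl | (h' | h') | h', hj⟩
    · exact absurd hj (lt_irrefl _)
    · exact absurd h.lt hj.not_gt
    · exact h'
    · exact absurd hj (h.h2 j h').1.not_gt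
    · exact absurd (hj.trans h.lt) (h.h3 j h').not_gt
  · intro h'
    exact ⟨Or.inr (Or.inr (Or.inl (Or.inl h'))), h.h1 j h'⟩

lemma filter_gt (h : Cfg x y z p q S1 S2 S3) :
    ((insert p (insert q (S1 ∪ S2 ∪ S3))).filter (q < ·)) = S3 := by
  ext j
  simp only [Finset.mem_filter, Finset.mem_insert, Finset.mem_union]
  constructor
  · rintro ⟨rfl | rfl | (h' | h') | h', hj⟩
    · exact absurd h.lt hj.not_gt
    · exact absurd hj (lt_irrefl _)
    · exact absurd ((h.h1 j h').trans h.lt) hj.not_gt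
    · exact absurd hj (h.h2 j h').2.not_gt
    · exact h'
  · intro h'
    exact ⟨Or.inr (Or.inr (Or.inr h')), h.h3 j h'⟩

lemma uniq (h : Cfg x y z p q S1 S2 S3) (h' : Cfg x y z p' q' S1' S2' S3')
    (e : insert p (insert q (S1 ∪ S2 ∪ S3)) = insert p' (insert q' (S1' ∪ S2' ∪ S3'))) :
    p = p' ∧ q = q' ∧ S1 ∪ S2 ∪ S3 = S1' ∪ S2' ∪ S3' := by
  set X := insert p (insert q (S1 ∪ S2 ∪ S3)) with hX
  have hpX : p ∈ X := by simp [hX]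
  have hqX : q ∈ X := by simp [hX]
  have hpX' : p' ∈ X := by simp [e]
  have hqX' : q' ∈ X := by simp [e]
  have key1 : ∀ a b : Fin N, a ∈ X → a < b → (X.filter (· < a)).card < (X.filter (· < b)).card := by
    intro a b ha hab
    refine Finset.card_lt_card ⟨fun j hj => ?_, fun hh => ?_⟩
    · rw [Finset.mem_filter] at hj ⊢
      exact ⟨hj.1, hj.2.trans hab⟩
    · have := hh (Finset.mem_filter.2 ⟨ha, hab⟩)
      simp at this
  have key2 : ∀ a b : Fin N, b ∈ X → a < b → (X.filter (b < ·)).card < (X.filter (a < ·)).card := by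
    intro a b ha hab
    refine Finset.card_lt_card ⟨fun j hj => ?_, fun hh => ?_⟩
    · rw [Finset.mem_filter] at hj ⊢
      exact ⟨hj.1, hab.trans hj.2⟩
    · have := hh (Finset.mem_filter.2 ⟨ha, hab⟩)
      simp at this
  have e1 : (X.filter (· < p)).card = x := by rw [h.filter_lt, h.c1]
  have e2 : (X.filter (· < p')).card = x := by rw [e, h'.filter_lt, h'.c1]
  have e3 : (X.filter (q < ·)).card = z := by rw [h.filter_gt, h.c3]
  have e4 : (X.filter (q' < ·)).card = z := by rw [e, h'.filter_gt, h'.c3]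
  have ep : p = p' := by
    rcases lt_trichotomy p p' with hl | hl | hl
    · have := key1 _ _ hpX hl; omega
    · exact hl
    · have := key1 _ _ hpX' hl; omega
  have eq : q = q' := by
    rcases lt_trichotomy q q' with hl | hl | hl
    · have := key2 _ _ hqX' hl; omega
    · exact hl
    · have := key2 _ _ hqX hl; omega
  refine ⟨ep, eq, ?_⟩
  have s1 : (X.erase p).erase q = S1 ∪ S2 ∪ S3 := by
    rw [hX, Finset.erase_insert h.notp, Finset.erase_insert h.notq]
  have s2 : (X.erase p').erase q' = S1' ∪ S2' ∪ S3' := by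
    rw [e, Finset.erase_insert h'.notp, Finset.erase_insert h'.notq]
  rw [← s1, ← s2, ep, eq]

lemma map {M : ℕ} (h : Cfg x y z p q S1 S2 S3) (f : Fin N → Fin M) (hf : StrictMono f) :
    Cfg x y z (f p) (f q) (S1.image f) (S2.image f) (S3.image f) where
  lt := hf h.lt
  h1 := by
    intro j hj
    obtain ⟨i, hi, rfl⟩ := Finset.mem_image.1 hj
    exact hf (h.h1 i hi)
  h2 := by
    intro j hj
    obtain ⟨i, hi, rfl⟩ := Finset.mem_image.1 hj
    exact ⟨hf (h.h2 i hi).1, hf (h.h2 i hi).2⟩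
  h3 := by
    intro j hj
    obtain ⟨i, hi, rfl⟩ := Finset.mem_image.1 hj
    exact hf (h.h3 i hi)
  c1 := by rw [Finset.card_image_of_injective _ hf.injective, h.c1]
  c2 := by rw [Finset.card_image_of_injective _ hf.injective, h.c2]
  c3 := by rw [Finset.card_image_of_injective _ hf.injective, h.c3]

lemma rev {M : ℕ} (h : Cfg x y z p q S1 S2 S3) (f : Fin N → Fin M) (hf : StrictAnti f) :
    Cfg z y x (f q) (f p) (S3.image f) (S2.image f) (S1.image f) where
  lt := hf h.lt
  h1 := by
    intro j hj
    obtain ⟨i, hi, rfl⟩ := Finset.mem_image.1 hj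
    exact hf (h.h3 i hi)
  h2 := by
    intro j hj
    obtain ⟨i, hi, rfl⟩ := Finset.mem_image.1 hj
    exact ⟨hf (h.h2 i hi).2, hf (h.h2 i hi).1⟩
  h3 := by
    intro j hj
    obtain ⟨i, hi, rfl⟩ := Finset.mem_image.1 hj
    exact hf (h.h1 i hi)
  c1 := by rw [Finset.card_image_of_injective _ hf.injective, h.c3]
  c2 := by rw [Finset.card_image_of_injective _ hf.injective, h.c2]
  c3 := by rw [Finset.card_image_of_injective _ hf.injective, h.c1]
end Cfg

namespace Ctx
variable {c : Ctx} {N M : ℕ} {D0 : Fin N → c.ISet} {δ x y z : ℕ}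

def AbilD (d : Bool) (D : Fin N → c.ISet) (p q : Fin N) (J : Set (Fin N)) : Prop :=
  if d then Abil D p q J else Abil D q p J

lemma abilD_comp (d : Bool) (D : Fin N → c.ISet) (f : Fin M → Fin N) (p q : Fin M)
    (J : Set (Fin M)) :
    AbilD d (fun a => D (f a)) p q J ↔ AbilD d D (f p) (f q) (f '' J) := by
  cases d
  · exact abil_comp D f q p J
  · exact abil_comp D f p q J

lemma AbilD.anti {d : Bool} {D : Fin N → c.ISet} {p q : Fin N} {J J' : Set (Fin N)}
    (h : AbilD d D p q J) (hJ : J' ⊆ J) : AbilD d D p q J' := by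
  cases d
  · exact Abil.anti (J := J) h hJ
  · exact Abil.anti (J := J) h hJ

def PosW (d : Bool) (x y z : ℕ) (D : Fin N → c.ISet) : Prop :=
  ∀ p q S1 S2 S3, Cfg x y z p q S1 S2 S3 → AbilD d D p q ((S1 ∪ S2 ∪ S3 : Finset (Fin N)) : Set (Fin N))

def NegW (d : Bool) (x y z : ℕ) (D : Fin N → c.ISet) : Prop :=
  ∀ p q S1 S2 S3, Cfg x y z p q S1 S2 S3 → ¬ AbilD d D p q ((S1 ∪ S2 ∪ S3 : Finset (Fin N)) : Set (Fin N))

lemma image_coe3 {M : ℕ} (f : Fin M → Fin N) (S1 S2 S3 : Finset (Fin M)) :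
    f '' ((S1 ∪ S2 ∪ S3 : Finset (Fin M)) : Set (Fin M)) =
    ((S1.image f ∪ S2.image f ∪ S3.image f : Finset (Fin N)) : Set (Fin N)) := by
  rw [← Finset.image_union, ← Finset.image_union, Finset.coe_image]

lemma PosW.comp {d : Bool} (h : PosW d x y z D0) (f : Fin M → Fin N) (hf : StrictMono f) :
    PosW d x y z (fun a => D0 (f a)) := by
  intro p q S1 S2 S3 hc
  rw [abilD_comp, image_coe3]
  exact h _ _ _ _ _ (hc.map f hf)

lemma NegW.comp {d : Bool} (h : NegW d x y z D0) (f : Fin M → Fin N) (hf : StrictMono f) :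
    NegW d x y z (fun a => D0 (f a)) := by
  intro p q S1 S2 S3 hc
  rw [abilD_comp, image_coe3]
  exact h _ _ _ _ _ (hc.map f hf)

lemma PosW.rev {d : Bool} (h : PosW d x y z D0) : PosW (!d) z y x (fun a => D0 (Fin.rev a)) := by
  intro p q S1 S2 S3 hc
  rw [abilD_comp, image_coe3]
  have := h _ _ _ _ _ (hc.rev Fin.rev Fin.rev_strictAnti)
  rw [Finset.union_comm (S3.image _), Finset.union_comm _ (S1.image _), ← Finset.union_assoc] at this
  cases d <;> exact this

lemma NegW.rev {d : Bool} (h : NegW d x y z D0) : NegW (!d) z y x (fun a => D0 (Fin.rev a)) := by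
  intro p q S1 S2 S3 hc
  rw [abilD_comp, image_coe3]
  have := h _ _ _ _ _ (hc.rev Fin.rev Fin.rev_strictAnti)
  rw [Finset.union_comm (S3.image _), Finset.union_comm _ (S1.image _), ← Finset.union_assoc] at this
  cases d <;> exact this

lemma ramseyW (d : Bool) (x y z p : ℕ) : ∃ N : ℕ, ∀ (c : Ctx) (D : Fin N → c.ISet),
    ∃ f : Fin p → Fin N, StrictMono f ∧
      (PosW d x y z (fun a => D (f a)) ∨ NegW d x y z (fun a => D (f a))) := by
  obtain ⟨N, hN⟩ := ramsey (x + y + z + 2) p p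
  refine ⟨N, fun c D => ?_⟩
  rcases hN (Fin N) (fun X => ∃ p q S1 S2 S3, Cfg x y z p q S1 S2 S3 ∧
    X = insert p (insert q (S1 ∪ S2 ∪ S3)) ∧
    AbilD d D p q ((S1 ∪ S2 ∪ S3 : Finset (Fin N)) : Set (Fin N))) Finset.univ (by simp)
    with ⟨S, -, hc, hP⟩ | ⟨S, -, hc, hP⟩
  all_goals
    have hsub : ∀ (p' q' : Fin p) (S1 S2 S3 : Finset (Fin p)),
      insert (S.orderEmbOfFin hc p') (insert (S.orderEmbOfFin hc q')
        (S1.image (S.orderEmbOfFin hc) ∪ S2.image (S.orderEmbOfFin hc)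
          ∪ S3.image (S.orderEmbOfFin hc))) ⊆ S := by
      intro p' q' S1 S2 S3 j hj
      simp only [Finset.mem_insert, Finset.mem_union, Finset.mem_image] at hj
      rcases hj with rfl | rfl | (⟨a, -, rfl⟩ | ⟨a, -, rfl⟩) | ⟨a, -, rfl⟩ <;>
        exact Finset.orderEmbOfFin_mem _ _ _
    refine ⟨S.orderEmbOfFin hc, (S.orderEmbOfFin hc).strictMono, ?_⟩
  · left
    intro p' q' S1 S2 S3 hcf
    have hcf' := hcf.map _ (S.orderEmbOfFin hc).strictMono
    obtain ⟨p2, q2, T1, T2, T3, hcf2, e, hab⟩ := hP _ (hsub p' q' S1 S2 S3) hcf'.card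
    obtain ⟨e1, e2, e3⟩ := hcf'.uniq hcf2 e
    rw [abilD_comp, image_coe3, e1, e2, e3]
    exact hab
  · right
    intro p' q' S1 S2 S3 hcf hab
    have hcf' := hcf.map _ (S.orderEmbOfFin hc).strictMono
    rw [abilD_comp, image_coe3] at hab
    exact hP _ (hsub p' q' S1 S2 S3) hcf'.card ⟨_, _, _, _, _, hcf', rfl, hab⟩

lemma ramseyL (ws : List (Bool × ℕ × ℕ × ℕ)) (p : ℕ) : ∃ N : ℕ, ∀ (c : Ctx) (D : Fin N → c.ISet),
    ∃ f : Fin p → Fin N, StrictMono f ∧ ∀ w ∈ ws,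
      (PosW w.1 w.2.1 w.2.2.1 w.2.2.2 (fun a => D (f a)) ∨
        NegW w.1 w.2.1 w.2.2.1 w.2.2.2 (fun a => D (f a))) := by
  induction ws with
  | nil => exact ⟨p, fun c D => ⟨id, strictMono_id, by simp⟩⟩
  | cons w ws ih =>
    obtain ⟨N1, h1⟩ := ih
    obtain ⟨N2, h2⟩ := ramseyW w.1 w.2.1 w.2.2.1 w.2.2.2 N1
    refine ⟨N2, fun c D => ?_⟩
    obtain ⟨f, hf, hw⟩ := h2 c D
    obtain ⟨g, hg, hws⟩ := h1 c (fun a => D (f a))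
    refine ⟨f ∘ g, hf.comp hg, fun w' hw' => ?_⟩
    rcases List.mem_cons.1 hw' with rfl | hw'
    · exact hw.imp (fun h => h.comp g hg) (fun h => h.comp g hg)
    · exact hws w' hw'

lemma NegW.negF (h : NegW true x y z D0) : NegF D0 x y z := by
  intro p q hpq J S1 S2 S3 h1 h2 h3 c1 c2 c3 hab
  obtain ⟨T1, hT1, e1⟩ := Finset.exists_subset_card_eq c1
  obtain ⟨T2, hT2, e2⟩ := Finset.exists_subset_card_eq c2
  obtain ⟨T3, hT3, e3⟩ := Finset.exists_subset_card_eq c3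
  refine h p q T1 T2 T3 ⟨hpq, fun j hj => (h1 j (hT1 hj)).2, fun j hj => (h2 j (hT2 hj)).2,
    fun j hj => (h3 j (hT3 hj)).2, e1, e2, e3⟩ (hab.anti ?_)
  intro j hj
  simp only [Finset.coe_union, Set.mem_union, Finset.mem_coe] at hj
  rcases hj with (hj | hj) | hj
  · exact (h1 j (hT1 hj)).1
  · exact (h2 j (hT2 hj)).1
  · exact (h3 j (hT3 hj)).1

lemma NegW.negB (h : NegW false x y z D0) : NegB D0 x y z := by
  intro p q hpq J S1 S2 S3 h1 h2 h3 c1 c2 c3 hab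
  obtain ⟨T1, hT1, e1⟩ := Finset.exists_subset_card_eq c1
  obtain ⟨T2, hT2, e2⟩ := Finset.exists_subset_card_eq c2
  obtain ⟨T3, hT3, e3⟩ := Finset.exists_subset_card_eq c3
  refine h p q T1 T2 T3 ⟨hpq, fun j hj => (h1 j (hT1 hj)).2, fun j hj => (h2 j (hT2 hj)).2,
    fun j hj => (h3 j (hT3 hj)).2, e1, e2, e3⟩ (Abil.anti (J := J) hab ?_)
  intro j hj
  simp only [Finset.coe_union, Set.mem_union, Finset.mem_coe] at hj
  rcases hj with (hj | hj) | hj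
  · exact (h1 j (hT1 hj)).1
  · exact (h2 j (hT2 hj)).1
  · exact (h3 j (hT3 hj)).1

lemma NegF.mono {x' y' z' : ℕ} (h : NegF D0 x y z) (hx : x ≤ x') (hy : y ≤ y') (hz : z ≤ z') :
    NegF D0 x' y' z' :=
  fun p q hpq J S1 S2 S3 h1 h2 h3 c1 c2 c3 =>
    h p q hpq J S1 S2 S3 h1 h2 h3 (hx.trans c1) (hy.trans c2) (hz.trans c3)

/-- sparse subtokens -/
def sp (n M N : ℕ) (h : (n + 1) * (M + 2) ≤ N) (t : Fin M) : Fin N :=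
  ⟨(n + 1) * (t.1 + 1), by
    have : (n + 1) * (t.1 + 1) < (n + 1) * (M + 2) :=
      Nat.mul_lt_mul_of_pos_left (by have := t.2; omega) (by omega)
    omega⟩

lemma sp_mono (n M N : ℕ) (h : (n + 1) * (M + 2) ≤ N) : StrictMono (sp n M N h) := by
  intro a b hab
  rw [Fin.lt_def] at hab ⊢
  exact Nat.mul_lt_mul_of_pos_left (by omega) (by omega)

lemma PosW.full {d : Bool} {n : ℕ} (h : PosW d x y z D0) (hx : x ≤ n) (hy : y ≤ n) (hz : z ≤ n)
    (hN : (n + 1) * (M + 2) ≤ N) (p q : Fin M) (hpq : p < q) (J1 J2 J3 : Finset (Fin M))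
    (h1 : ∀ j ∈ J1, j < p) (h2 : ∀ j ∈ J2, p < j ∧ j < q) (h3 : ∀ j ∈ J3, q < j)
    (c1 : J1.card ≤ x) (c2 : J2.card ≤ y) (c3 : J3.card ≤ z) :
    AbilD d (fun a => D0 (sp n M N hN a)) p q ((J1 ∪ J2 ∪ J3 : Finset (Fin M)) : Set (Fin M)) := by
  set f := sp n M N hN with hf
  have hmono : StrictMono f := sp_mono n M N hN
  have hp0 : n + 1 ≤ (f p).1 := Nat.le_mul_of_pos_right _ (by omega)
  have hpq' : (f p).1 + (n + 1) ≤ (f q).1 := by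
    have : (n + 1) * (p.1 + 1) + (n + 1) = (n + 1) * (p.1 + 2) := by ring
    have h2 : (n + 1) * (p.1 + 2) ≤ (n + 1) * (q.1 + 1) :=
      Nat.mul_le_mul_left _ (by rw [Fin.lt_def] at hpq; omega)
    simp only [hf, sp]
    omega
  have hq' : (f q).1 + (n + 1) ≤ N := by
    have : (n + 1) * (q.1 + 1) + (n + 1) = (n + 1) * (q.1 + 2) := by ring
    have h2 : (n + 1) * (q.1 + 2) ≤ (n + 1) * (M + 2) :=
      Nat.mul_le_mul_left _ (by have := q.2; omega)
    simp only [hf, sp]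
    omega
  have hcard : ∀ J : Finset (Fin M), (J.image f).card = J.card := fun J =>
    Finset.card_image_of_injective _ hmono.injective
  obtain ⟨T1, hT1, hT1', e1⟩ := Finset.exists_subsuperset_card_eq (s := J1.image f)
    (t := iv N 0 (f p).1) (n := x) (by
      intro j hj
      obtain ⟨i, hi, rfl⟩ := Finset.mem_image.1 hj
      have := hmono (h1 i hi)
      rw [Fin.lt_def] at this
      exact mem_iv.2 ⟨Nat.zero_le _, this⟩) (by rw [hcard]; exact c1)
      (by rw [card_iv (by omega)]; omega)
  obtain ⟨T2, hT2, hT2', e2⟩ := Finset.exists_subsuperset_card_eq (s := J2.image f)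
    (t := iv N ((f p).1 + 1) (f q).1) (n := y) (by
      intro j hj
      obtain ⟨i, hi, rfl⟩ := Finset.mem_image.1 hj
      have := hmono (h2 i hi).1
      have h' := hmono (h2 i hi).2
      rw [Fin.lt_def] at this h'
      exact mem_iv.2 ⟨this, h'⟩) (by rw [hcard]; exact c2)
      (by rw [card_iv (by omega)]; omega)
  obtain ⟨T3, hT3, hT3', e3⟩ := Finset.exists_subsuperset_card_eq (s := J3.image f)
    (t := iv N ((f q).1 + 1) N) (n := z) (by
      intro j hj
      obtain ⟨i, hi, rfl⟩ := Finset.mem_image.1 hj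
      have := hmono (h3 i hi)
      rw [Fin.lt_def] at this
      exact mem_iv.2 ⟨this, Fin.is_lt _⟩) (by rw [hcard]; exact c3)
      (by rw [card_iv (by omega)]; omega)
  rw [abilD_comp, image_coe3]
  refine (h (f p) (f q) T1 T2 T3 ⟨hmono hpq, ?_, ?_, ?_, e1, e2, e3⟩).anti ?_
  · intro j hj
    have := mem_iv.1 (hT1' hj)
    rw [Fin.lt_def]; omega
  · intro j hj
    have := mem_iv.1 (hT2' hj)
    exact ⟨by rw [Fin.lt_def]; omega, by rw [Fin.lt_def]; omega⟩
  · intro j hj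
    have := mem_iv.1 (hT3' hj)
    rw [Fin.lt_def]; omega
  · exact_mod_cast Finset.union_subset_union (Finset.union_subset_union hT1 hT2) hT3
end Ctx
end TN

namespace TN
open Filter Classical
namespace Ctx
variable {c : Ctx} {N M : ℕ} {D0 D : Fin N → c.ISet} {t : ℕ}

def Done (t : ℕ) (D : Fin N → c.ISet) : Prop :=
  ∀ᶠ n in c.U, ∃ v C, IsCopy (c.G n) (c.col n) t t v C ∧ ∀ x ∈ C, ∃ i, x ∈ D i n

lemma Done.comp {f : Fin M → Fin N} (h : Done t (fun a => D (f a))) : Done t D := by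
  filter_upwards [h] with n ⟨v, C, h1, h2⟩
  exact ⟨v, C, h1, fun x hx => (h2 x hx).imp' f (fun _ h => h)⟩

lemma Done.con (h : Done t D) (hD : Con D0 D) : Done t D0 := by
  filter_upwards [h] with n ⟨v, C, h1, h2⟩
  exact ⟨v, C, h1, fun x hx => (h2 x hx).imp (fun i h => hD.le i n h)⟩

lemma done_of_ex {L K : Set (Fin N)} (hst : Stable D0) (h : Ex D0 t t L K) : Done t D0 := by
  filter_upwards [h D0 (Con.refl hst.big)] with n ⟨l, hl, v, hv, C, hC, hx⟩
  refine ⟨v, C, hC, fun x hxC => ?_⟩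
  by_cases e : x = v
  · exact ⟨l, e ▸ hv⟩
  · obtain ⟨k, -, hk⟩ := hx x hxC e
    exact ⟨k, hk⟩

lemma done_of_rt {D' : Fin N → c.ISet} {r : Fin N} {A Q : Set (Fin N)} (hD' : Con D0 D')
    (h : Rt D0 D' t t r A Q) : Done t D0 := by
  filter_upwards [h, (hD'.big r).nonempty] with n h ⟨v, hv⟩
  obtain ⟨C, hC, hx⟩ := h v hv
  refine ⟨v, C, hC, fun x hxC => ?_⟩
  by_cases e : x = v
  · exact ⟨r, hD'.le _ _ (e ▸ hv)⟩
  · obtain ⟨⟨k, -, hk⟩, -⟩ := hx x hxC e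
    exact ⟨k, hk⟩

lemma card_le_fin (S : Finset (Fin M)) : S.card ≤ M := by
  simpa using Finset.card_le_univ S

lemma done_one {n : ℕ} (hn : n = Ng t t) (hst : Stable D0) (h : PosW true 0 n n D0)
    (hN : (n + 1) * (n + 2) ≤ N) : Done t D0 := by
  refine Done.comp (f := sp n n N hN) ?_
  have hst' := hst.comp (sp n n N hN) (sp_mono n n N hN).injective
  have hpos : 0 < n := hn ▸ Ng_pos t t
  obtain ⟨D', hD', hrt⟩ := caseOne (δ := t) hst' (fun p q hpq => by
    have := h.full (Nat.zero_le _) le_rfl le_rfl hN p q hpq ∅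
      (Finset.univ.filter fun j => p < j ∧ j < q) (Finset.univ.filter fun j => q < j)
      (by simp) (by simp) (by simp) (by simp) (card_le_fin _) (card_le_fin _)
    refine Abil.anti (J := _) this ?_
    intro j hj
    simp only [Finset.coe_union, Set.mem_union, Finset.mem_coe, Finset.mem_filter,
      Finset.mem_univ, true_and]
    rcases lt_or_gt_of_ne hj.2 with h' | h'
    · exact Or.inl (Or.inr ⟨hj.1, h'⟩)
    · exact Or.inr h') t 0 ⟨n - 1, by omega⟩ (by simp only []; omega) _ (Con.refl hst'.big)
  exact done_of_rt hD' hrt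

lemma done_two {n : ℕ} (hn : n = Ng t t) (hst : Stable D0) (h : PosW true n 0 n D0)
    (hN : (n + 1) * (n + 2) ≤ N) : Done t D0 := by
  refine Done.comp (f := sp n n N hN) ?_
  have hst' := hst.comp (sp n n N hN) (sp_mono n n N hN).injective
  have hpos : 0 < n := hn ▸ Ng_pos t t
  obtain ⟨D', hD', hrt⟩ := caseTwo (δ := t) hst' (fun p q hpq => by
    have := h.full le_rfl (Nat.zero_le _) le_rfl hN p q hpq
      (Finset.univ.filter fun j => j < p) ∅ (Finset.univ.filter fun j => q < j)
      (by simp) (by simp) (by simp) (card_le_fin _) (by simp) (card_le_fin _)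
    refine Abil.anti (J := _) this ?_
    intro j hj
    simp only [Finset.coe_union, Set.mem_union, Finset.mem_coe, Finset.mem_filter,
      Finset.mem_univ, true_and]
    rcases hj with h' | h'
    · exact Or.inl (Or.inl h')
    · exact Or.inr h') t 0 ⟨n - 1, by omega⟩ (by simp only []; omega) _ (Con.refl hst'.big)
  exact done_of_rt hD' hrt

lemma done_B {n1 n2 : ℕ} (hn : 0 < n2) (h12 : n1 ≤ n2) (hst : Stable D0)
    (g2 : NegW true n1 0 n1 D0) (gQ : NegW true 0 n2 0 D0) (hN : n2 + NB t n2 t ≤ N) :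
    Done t D0 := by
  have := caseB (δ := t) hn hst (g2.negF.mono h12 le_rfl h12) gQ.negF t (iv N 0 n2) n2
    (fun l hl => (mem_iv.1 hl).2) (by rw [card_iv (by omega)]; omega) hN
  exact done_of_ex hst this

lemma done_A {n1 n2 A : ℕ} (hn : 0 < n1) (hA : A = n1 + NA t n1 t) (hA2 : A ≤ n2)
    (hst : Stable D0) (g1 : NegW true 0 n1 n1 D0) (g2 : NegW true n1 0 n1 D0)
    (g4 : NegW false n1 n1 0 D0) (pQ : PosW true 0 n2 0 D0) (pQ' : PosW false 0 n2 0 D0)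
    (hN : (n2 + 1) * (A + 2) ≤ N) : Done t D0 := by
  refine Done.comp (f := sp n2 A N hN) ?_
  have hm := sp_mono n2 A N hN
  have hst' := hst.comp (sp n2 A N hN) hm.injective
  have hfull : ∀ d, PosW d 0 n2 0 D0 → ∀ p q : Fin A, p < q →
      AbilD d (fun a => D0 (sp n2 A N hN a)) p q {j | p < j ∧ j < q} := by
    intro d h p q hpq
    refine (h.full (Nat.zero_le _) le_rfl (Nat.zero_le _) hN p q hpq ∅
      (Finset.univ.filter fun j => p < j ∧ j < q) ∅
      (by simp) (by simp) (by simp) (by simp) ((card_le_fin _).trans hA2) (by simp)).anti ?_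
    intro j hj
    simpa using hj
  have := (caseA (δ := t) hn hst' (g1.comp _ hm).negF (g2.comp _ hm).negF (g4.comp _ hm).negB
    (hfull true pQ) (hfull false pQ') t).1 (iv A 0 n1) n1
    (fun l hl => (mem_iv.1 hl).2) (by rw [card_iv (by omega)]; omega) hA.ge
  exact done_of_ex hst' this
end Ctx

open Ctx

theorem core (t : ℕ) : ∃ N : ℕ, ∀ (c : Ctx) (D : Fin N → c.ISet), Tok D → (∀ i, Big (D i)) →
    Done t D := by
  obtain ⟨n1, hn1⟩ : ∃ n1, n1 = Ng t t := ⟨_, rfl⟩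
  have hn1p : 0 < n1 := hn1 ▸ Ng_pos t t
  obtain ⟨A, hA⟩ : ∃ A, A = n1 + NA t n1 t := ⟨_, rfl⟩
  obtain ⟨B, hB⟩ : ∃ B, B = A + NB t A t := ⟨_, rfl⟩
  obtain ⟨p, hp⟩ : ∃ p, p = (n1 + 1) * (n1 + 2) + (A + 1) * (A + 2) + B := ⟨_, rfl⟩
  obtain ⟨N, hN⟩ := ramseyL [(true, 0, n1, n1), (true, n1, 0, n1), (true, 0, A, 0),
    (false, n1, n1, 0), (false, n1, 0, n1), (false, 0, A, 0)] p
  refine ⟨N, fun c D hT hB => ?_⟩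
  obtain ⟨D1, hD1, hst1⟩ := stabilize hT hB
  refine Done.con ?_ hD1
  obtain ⟨f, hf, hw⟩ := hN c D1
  refine Done.comp (f := f) ?_
  have hst := hst1.comp f hf.injective
  simp only [List.forall_mem_cons, List.not_mem_nil, false_imp_iff, implies_true, and_true] at hw
  obtain ⟨w1, w2, w3, w4, w5, w6⟩ := hw
  generalize (fun a => D1 (f a)) = E at *
  have hrev := hst.comp Fin.rev Fin.rev_injective
  rcases w1 with w1 | w1
  · exact done_one hn1 hst w1 (by omega)
  rcases w2 with w2 | w2
  · exact done_two hn1 hst w2 (by omega)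
  rcases w4 with w4 | w4
  · exact Done.comp (f := Fin.rev) (done_one hn1 hrev w4.rev (by omega))
  rcases w5 with w5 | w5
  · exact Done.comp (f := Fin.rev) (done_two hn1 hrev w5.rev (by omega))
  rcases w3 with w3 | w3
  · rcases w6 with w6 | w6
    · exact done_A hn1p hA le_rfl hst w1 w2 w4 w3 w6 (by omega)
    · exact Done.comp (f := Fin.rev) (done_B (n1 := n1) (n2 := A) (by omega) (by omega) hrev
        w5.rev w6.rev (by omega))
  · exact done_B (n1 := n1) (n2 := A) (by omega) (by omega) hst w2 w3 (by omega)
end TN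

namespace TN
open Filter Classical
open Ctx

lemma width_le {n k : ℕ} (B : Fin k → Finset (Fin n)) (i : Fin k) : blockadeWidth B ≤ (B i).card :=
  ciInf_le (OrderBot.bddBelow _) i

lemma dg_le_gdeg {n : ℕ} (G : SimpleGraph (Fin n)) (S : Finset (Fin n)) (v : Fin n) :
    dg G S v ≤ gdeg G v := by
  unfold dg gdeg
  rw [Nat.card_coe_set_eq, ← Set.ncard_coe_finset]
  refine Set.ncard_le_ncard ?_ (Set.toFinite _)
  intro u hu
  simp only [Finset.coe_filter] at hu
  exact hu.2

/-- A bad sequence of blockades produces a rainbow copy of `T`. -/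
lemma rainbow_tree (t : ℕ) (T : SimpleGraph (Fin t)) (hT : T.IsTree)
    (N k : ℕ → ℕ) (G : ∀ n, SimpleGraph (Fin (N n))) (B : ∀ n, Fin (k n) → Finset (Fin (N n)))
    (hB : ∀ n, IsBlockade (B n)) (hk : ∀ n, n + 2 ≤ k n)
    (hdeg : ∀ n v, (n + 2) * gdeg (G n) v < blockadeWidth (B n))
    (hcoh : ∀ n, ∀ X Y : Finset (Fin (N n)), Disjoint X Y →
      blockadeWidth (B n) ≤ (n + 2) * X.card → blockadeWidth (B n) ≤ (n + 2) * Y.card →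
      ∃ x ∈ X, ∃ y ∈ Y, (G n).Adj x y) :
    ∃ n, ∃ f : Fin t → Fin (N n), ∃ β : Fin t → Fin (k n), Function.Injective β ∧
      (∀ u, f u ∈ B n (β u)) ∧ ∀ u v, T.Adj u v ↔ (G n).Adj (f u) (f v) := by
  have hge : ∀ m : ℕ, ∀ᶠ n in (hyperfilter ℕ : Filter ℕ), m ≤ n := fun m =>
    (Nat.hyperfilter_le_atTop) (eventually_ge_atTop m)
  have hpos : ∀ n, 0 < blockadeWidth (B n) := by
    intro n
    obtain ⟨v, -⟩ := (hB n).1 ⟨0, by have := hk n; omega⟩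
    exact lt_of_le_of_lt (Nat.zero_le _) (hdeg n v)
  let col : ∀ n, Fin (N n) → ℕ := fun n v =>
    if h : ∃ i : Fin (k n), v ∈ B n i then h.choose.1 else 0
  have hcol : ∀ n i v, v ∈ B n i → col n v = i.1 := by
    intro n i v hv
    have h : ∃ i : Fin (k n), v ∈ B n i := ⟨i, hv⟩
    simp only [col, dif_pos h]
    by_contra hne
    have hd := (hB n).2 h.choose i (fun e => hne (by rw [e]))
    exact Finset.disjoint_left.1 hd h.choose_spec hv
  let c : Ctx :=
    { V := fun n => Fin (N n)
      G := G
      col := col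
      W := fun n => blockadeWidth (B n)
      U := hyperfilter ℕ
      hW := Eventually.of_forall hpos
      hdeg := by
        intro m
        filter_upwards [hge m] with n hn v S
        refine lt_of_le_of_lt (Nat.mul_le_mul ?_ (dg_le_gdeg _ S v)) (hdeg n v)
        omega
      hcoh := by
        intro m
        filter_upwards [hge m] with n hn X Y hXY hX hY
        exact hcoh n X Y hXY (hX.trans (Nat.mul_le_mul_right _ (by omega)))
          (hY.trans (Nat.mul_le_mul_right _ (by omega))) }
  obtain ⟨M, hM⟩ := core t
  have hsub : ∀ n (i : Fin (k n)), ∃ S ⊆ B n i, S.card = blockadeWidth (B n) := fun n i =>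
    Finset.exists_subset_card_eq (width_le (B n) i)
  choose S hS hSc using hsub
  let D : Fin M → c.ISet := fun i n => if h : i.1 < k n then S n ⟨i.1, h⟩ else (∅ : Finset (Fin (N n)))
  have hD : ∀ i n, ∀ x ∈ D i n, ∃ h : i.1 < k n, x ∈ B n ⟨i.1, h⟩ := by
    intro i n x hx
    by_cases h : i.1 < k n
    · simp only [D, dif_pos h] at hx
      exact ⟨h, hS _ _ hx⟩
    · simp [D, dif_neg h] at hx
  have hDone := hM c D
    ⟨by
      intro i j hij n x hx y hy
      obtain ⟨h1, h2⟩ := hD i n x hx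
      obtain ⟨h3, h4⟩ := hD j n y hy
      have e1 : c.col n x = i.1 := hcol n _ x h2
      have e2 : c.col n y = j.1 := hcol n _ y h4
      rw [e1, e2]
      exact fun e => hij (Fin.ext e),
    by
      intro i n
      by_cases h : i.1 < k n
      · simp only [D, dif_pos h]
        exact (hSc _ _).le
      · simp [D, dif_neg h]⟩
    (by
      intro i
      refine ⟨1, ?_⟩
      change ∀ᶠ n in (hyperfilter ℕ : Filter ℕ), _
      filter_upwards [hge i.1] with n hn
      have h : i.1 < k n := by have := hk n; omega
      simp only [D, dif_pos h, one_mul]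
      exact (hSc _ _).ge)
  obtain ⟨n, v, C, hC, hx⟩ := hDone.exists
  obtain ⟨f, hfC, hcf, hadj⟩ := hC.tree hT
  have hβ : ∀ u, ∃ i : Fin (k n), f u ∈ B n i := by
    intro u
    obtain ⟨i, hi⟩ := hx _ (hfC u)
    obtain ⟨h1, h2⟩ := hD i n _ hi
    exact ⟨_, h2⟩
  choose β hβ using hβ
  refine ⟨n, f, β, ?_, hβ, hadj⟩
  intro u u' e
  refine hcf u u' ?_
  change col n (f u) = col n (f u')
  rw [hcol n _ _ (hβ u), hcol n _ _ (hβ u'), e]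
end TN

/-- If a set `𝒜` of ordered graphs does not have the sparse rainbow strong EH-property, then
every tree admits a numbering under which the resulting ordered graph contains no member
of `𝒜`. -/
theorem tree_numbering_of_not_SRSEH (𝒜 : Set OGraph) (h : ¬ SRSEH 𝒜) (t : ℕ)
    (T : SimpleGraph (Fin t)) (hT : T.IsTree) :
    ∃ σ : Equiv.Perm (Fin t), ∀ H ∈ 𝒜, ¬ OContains (SimpleGraph.comap σ T) H.2 := by
  by_contra hcon
  push Not at hcon
  have hn : ∀ n : ℕ, ∃ (N k : ℕ) (G : SimpleGraph (Fin N)) (B : Fin k → Finset (Fin N)),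
      IsBlockade B ∧ n + 2 ≤ k ∧ (∀ H ∈ 𝒜, ¬ ORainbow G H.2 B) ∧
      (∀ v, (n + 2) * gdeg G v < blockadeWidth B) ∧
      (∀ X Y : Finset (Fin N), Disjoint X Y →
        blockadeWidth B ≤ (n + 2) * X.card → blockadeWidth B ≤ (n + 2) * Y.card →
        ∃ x ∈ X, ∃ y ∈ Y, G.Adj x y) := by
    intro n
    have hc0 : (0 : ℝ) < n + 2 := by positivity
    by_contra hno
    refine h ⟨1 / ((n : ℝ) + 2), by positivity, ?_, ?_⟩
    · rw [div_lt_one hc0]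
      have : (0 : ℝ) ≤ n := Nat.cast_nonneg n
      linarith
    · intro N k G B hB hR hk hH hdeg
      by_contra hac
      refine hno ⟨N, k, G, B, hB, ?_, hH, ?_, ?_⟩
      · rw [one_div_one_div] at hk
        exact_mod_cast hk
      · intro v
        have := hdeg v
        rw [div_mul_eq_mul_div, one_mul, lt_div_iff₀ hc0, mul_comm] at this
        exact_mod_cast this
      · intro X Y hXY hX hY
        by_contra hne
        push Not at hne
        refine hac ⟨X, Y, hXY, hne, ?_, ?_⟩
        · rw [div_mul_eq_mul_div, one_mul, div_le_iff₀ hc0, mul_comm]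
          exact_mod_cast hX
        · rw [div_mul_eq_mul_div, one_mul, div_le_iff₀ hc0, mul_comm]
          exact_mod_cast hY
  choose N k G B hB hk hH hdeg hcoh using hn
  obtain ⟨n, f, β, hβ, hfβ, hadj⟩ := TN.rainbow_tree t T hT N k G B hB hk hdeg hcoh
  have hfinj : Function.Injective f := by
    intro u u' e
    by_contra hne
    have hd := (hB n).2 (β u) (β u') (fun e' => hne (hβ e'))
    exact Finset.disjoint_left.1 hd (hfβ u) (e ▸ hfβ u')
  have hmono : StrictMono (f ∘ Tuple.sort f) :=
    (Tuple.monotone_sort f).strictMono_of_injective (hfinj.comp (Tuple.sort f).injective)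
  obtain ⟨H, hHA, g, hg, hgadj⟩ := hcon (Tuple.sort f)
  refine hH n H hHA ⟨fun u => f (Tuple.sort f (g u)), fun a b hab => hmono (hg hab), ?_,
    fun u => β (Tuple.sort f (g u)), ?_, fun u => hfβ _⟩
  · intro u v
    rw [hgadj u v, ← hadj]
    rfl
  · exact hβ.comp ((Tuple.sort f).injective.comp hg.injective)
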